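/- (L⁴ₜL⁸ₓ bound in two dimensions.) For n = 2 there exists a constant C > 0 such that every solution u as in the setup with λ > 0 satisfies ‖u‖²_{L⁴ₜL⁸ₓ} := ( ∫_ℝ ( ∫_{ℝ²} |u(t,x)|⁸ dx )^{1/2} dt )^{1/2} ≤ C ‖u₀‖^{3/2}_{L²(ℝ²)} ( sup_{t∈ℝ} ‖∇u(t,·)‖_{L²(ℝ²)} )^{1/2}. -/

import Mathlib

open MeasureTheory Complex
open scoped FourierTransform

noncomputable section

/-- Euclidean space `ℝⁿ`. -/
abbrev En (n : ℕ) := EuclideanSpace ℝ (Fin n)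

/-- Partial derivative `∂_{x_j} f` of a complex-valued function. -/
noncomputable def pd {n : ℕ} (j : Fin n) (f : En n → ℂ) (x : En n) : ℂ :=
  fderiv ℝ f x (EuclideanSpace.single j 1)

/-- Laplacian `Δf` of a complex-valued function. -/
noncomputable def lap {n : ℕ} (f : En n → ℂ) (x : En n) : ℂ := ∑ j, pd j (pd j f) x

/-- Partial derivative `∂_{x_j} f` of a real-valued function. -/
noncomputable def rpd {n : ℕ} (j : Fin n) (f : En n → ℝ) (x : En n) : ℝ :=
  fderiv ℝ f x (EuclideanSpace.single j 1)

/-- Laplacian `Δf` of a real-valued function. -/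
noncomputable def rlap {n : ℕ} (f : En n → ℝ) (x : En n) : ℝ := ∑ j, rpd j (rpd j f) x

/-- `u : ℝ × ℝⁿ → ℂ` is a smooth solution of the NLS `i∂ₜu + Δu = λ|u|^{p-1}u`,
Schwartz class in `x` locally uniformly in `t`. -/
structure NLSSolution (n : ℕ) (p lam : ℝ) (u : ℝ → En n → ℂ) : Prop where
  smooth : ContDiff ℝ (⊤ : ℕ∞) (fun q : ℝ × En n => u q.1 q.2)
  decay : ∀ (k N : ℕ) (T : ℝ), ∃ C : ℝ, ∀ t : ℝ, |t| ≤ T → ∀ x : En n,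
      ‖x‖ ^ N * ‖iteratedFDeriv ℝ k (u t) x‖ ≤ C
  eq : ∀ (t : ℝ) (x : En n),
      Complex.I * deriv (fun s => u s x) t + lap (u t) x
        = (lam : ℂ) * ((‖u t x‖ ^ (p - 1) : ℝ) : ℂ) * u t x

/-- The momentum density `p_j = Im(ū ∂_{x_j} u)`. -/
noncomputable def mom {n : ℕ} (u : ℝ → En n → ℂ) (j : Fin n) (t : ℝ) (x : En n) : ℝ :=
  (starRingEnd ℂ (u t x) * pd j (u t) x).im

/-- The Morawetz action centered at `y`:
`M_y(t) = ∫ ((x-y)/|x-y|) · Im(ū ∇u)(t,x) dx`. -/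
noncomputable def morAction {n : ℕ} (u : ℝ → En n → ℂ) (y : En n) (t : ℝ) : ℝ :=
  ∫ x : En n, ∑ j, ((x j - y j) / ‖x - y‖) * mom u j t x

open scoped ENNReal

theorem aux_ofReal_contDiff {V : Type*} [NormedAddCommGroup V] [NormedSpace ℝ V] {φ : V → ℝ}
    {n : WithTop ℕ∞} (h : ContDiff ℝ n φ) : ContDiff ℝ n (fun x => (φ x : ℂ)) :=
  Complex.ofRealCLM.contDiff.comp h

theorem plancherel_L1L2 {V : Type*} [NormedAddCommGroup V] [InnerProductSpace ℝ V]
    [FiniteDimensional ℝ V] [MeasurableSpace V] [BorelSpace V] {g : V → ℂ}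
    (h1 : Integrable g) (h2 : MemLp g 2) :
    ∫⁻ x, ‖𝓕 g x‖ₑ ^ 2 = ∫⁻ x, ‖g x‖ₑ ^ 2 := by
  set G := h2.toLp g with hG
  have hcont : Continuous (𝓕 g) :=
    VectorFourier.fourierIntegral_continuous Real.continuous_fourierChar
      (by exact continuous_inner) h1
  have key : (𝓕 g) =ᵐ[volume] (𝓕 G : Lp (α := V) ℂ 2 volume) := by
    apply ae_eq_of_integral_contDiff_smul_eq
    · exact hcont.locallyIntegrable
    · exact (Lp.memLp _).locallyIntegrable (by norm_num)
    · intro φ hφ hc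
      have hφ' : ContDiff ℝ (⊤ : ℕ∞) (fun x => (φ x : ℂ)) := aux_ofReal_contDiff hφ
      have hc' : HasCompactSupport (fun x => (φ x : ℂ)) :=
        hc.comp_left (g := fun r : ℝ => (r : ℂ)) (by simp)
      set ψ := hc'.toSchwartzMap hφ' with hψ
      have e1 := MeasureTheory.Lp.fourier_toTemperedDistribution_eq G
      have e2 := congrArg (fun T => T ψ) e1
      simp only [TemperedDistribution.fourier_apply, Lp.toTemperedDistribution_apply] at e2
      have e3 : ∫ x, φ x • (𝓕 G : Lp (α := V) ℂ 2 volume) x = ∫ x, ψ x • (𝓕 G : Lp (α := V) ℂ 2 volume) x := by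
        congr 1
      have e4 : ∫ x, φ x • 𝓕 g x = ∫ x, 𝓕 g x • ψ x := by
        congr 1; ext x; simp [ψ, mul_comm]
      have e5 := VectorFourier.integral_fourierIntegral_smul_eq_flip (μ := volume) (ν := volume)
        (L := innerₗ V) (f := g) (g := ψ) Real.continuous_fourierChar
        (by exact continuous_inner) h1 ψ.integrable
      rw [e3, e4, ← e2]
      refine Eq.trans e5 ?_
      apply integral_congr_ae
      filter_upwards [h2.coeFn_toLp] with x hx
      rw [hG, hx, smul_eq_mul, smul_eq_mul, mul_comm]
      congr 1
      rw [SchwartzMap.fourier_coe, flip_innerₗ]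
      rfl
  have a1 : eLpNorm (𝓕 g) 2 volume = eLpNorm g 2 volume := by
    rw [eLpNorm_congr_ae key]
    have := MeasureTheory.Lp.norm_fourier_eq G
    rw [Lp.norm_def, Lp.norm_def, ENNReal.toReal_eq_toReal_iff' (Lp.eLpNorm_ne_top _) (Lp.eLpNorm_ne_top _)] at this
    rw [this, hG, eLpNorm_congr_ae h2.coeFn_toLp]
  have a2 : ∀ f : V → ℂ, ∫⁻ x, ‖f x‖ₑ ^ 2 = eLpNorm f 2 volume ^ 2 := by
    intro f
    rw [eLpNorm_eq_lintegral_rpow_enorm_toReal (by norm_num) (by norm_num), ← ENNReal.rpow_natCast, ← ENNReal.rpow_mul]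
    simp
  rw [a2, a2, a1]


theorem lint_Ioc_id (b : ℝ) (hb : 0 ≤ b) :
    ∫⁻ l in Set.Ioc 0 b, ENNReal.ofReal l = ENNReal.ofReal (b ^ 2 / 2) := by
  rw [← ofReal_integral_eq_lintegral_ofReal]
  · rw [← intervalIntegral.integral_of_le hb, integral_id]; simp
  · exact (continuous_id.integrableOn_Icc).mono_set Set.Ioc_subset_Icc_self
  · filter_upwards [ae_restrict_mem measurableSet_Ioc] with l hl using hl.1.le

/-- coordinates -/
def toE : ℝ × ℝ → En 2 := fun q => !₂[q.1, q.2]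

theorem toE_mp : MeasurePreserving toE := by
  have h1 := (volume_preserving_finTwoArrow ℝ).symm
  have h2 := (EuclideanSpace.volume_preserving_symm_measurableEquiv_toLp (Fin 2)).symm
  have h3 := h2.comp h1
  have e : toE = ⇑(MeasurableEquiv.toLp 2 (Fin 2 → ℝ)).symm.symm ∘ ⇑MeasurableEquiv.finTwoArrow.symm := by
    funext q; rfl
  rw [e]
  exact h3

theorem toE_emb : MeasurableEmbedding toE := by
  have h1 := (MeasurableEquiv.finTwoArrow (α := ℝ)).symm.measurableEmbedding
  have h2 := (MeasurableEquiv.toLp 2 (Fin 2 → ℝ)).measurableEmbedding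
  have h3 := h2.comp h1
  have e : toE = ⇑(MeasurableEquiv.toLp 2 (Fin 2 → ℝ)) ∘ ⇑MeasurableEquiv.finTwoArrow.symm := by
    funext q; rfl
  rw [e]
  exact h3

theorem toE_cont : Continuous toE := by
  unfold toE
  refine (PiLp.continuous_toLp 2 _).comp ?_
  refine continuous_pi fun i => ?_
  fin_cases i
  · exact continuous_fst
  · exact continuous_snd

theorem norm_toE (q : ℝ × ℝ) : ‖toE q‖ ^ 2 = q.1 ^ 2 + q.2 ^ 2 := by
  rw [EuclideanSpace.norm_sq_eq]; simp [toE, Fin.sum_univ_two]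

def polE (r θ : ℝ) : En 2 := toE (r * Real.cos θ, r * Real.sin θ)

theorem norm_polE {r : ℝ} (hr : 0 ≤ r) (θ : ℝ) : ‖polE r θ‖ = r := by
  have : ‖polE r θ‖ ^ 2 = r ^ 2 := by
    rw [polE, norm_toE]; simp only
    linear_combination r ^ 2 * Real.cos_sq_add_sin_sq θ
  exact (pow_left_inj₀ (norm_nonneg _) hr (by norm_num)).1 this

theorem polE_cont : Continuous (fun q : ℝ × ℝ => polE q.1 q.2) := by
  unfold polE
  exact toE_cont.comp (by fun_prop)

theorem lint_polar (f : En 2 → ℝ≥0∞) (hf : Measurable f) :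
    ∫⁻ x, f x = ∫⁻ θ in Set.Ioo (-Real.pi) Real.pi, ∫⁻ r in Set.Ioi 0,
      ENNReal.ofReal r * f (polE r θ) := by
  rw [← toE_mp.lintegral_comp_emb toE_emb, ← lintegral_comp_polarCoord_symm]
  rw [polarCoord_target, Measure.volume_eq_prod, ← Measure.prod_restrict, lintegral_prod_symm]
  · rfl
  · apply Measurable.aemeasurable
    apply Measurable.mul
    · fun_prop
    · exact hf.comp (polE_cont.measurable)

theorem lint_inv_norm (A : ℝ) (hA : 0 ≤ A) :
    ∫⁻ x : En 2, Set.indicator {x | ‖x‖ < A} (fun x => ENNReal.ofReal (‖x‖⁻¹)) x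
      ≤ ENNReal.ofReal (2 * Real.pi * A) := by
  rw [lint_polar _ (by
    apply Measurable.indicator
    · fun_prop
    · exact measurableSet_lt measurable_norm measurable_const)]
  calc _ ≤ ∫⁻ θ in Set.Ioo (-Real.pi) Real.pi, ∫⁻ r in Set.Ioi (0:ℝ), (Set.Iio A).indicator 1 r := by
        apply lintegral_mono; intro θ
        apply setLIntegral_mono' measurableSet_Ioi
        intro r hr
        have hr' : (0:ℝ) < r := hr
        by_cases h : r < A
        · rw [Set.indicator_of_mem (by simpa [norm_polE hr'.le] using h),
            Set.indicator_of_mem (by simpa using h), norm_polE hr'.le, ← ENNReal.ofReal_mul hr'.le, mul_inv_cancel₀ hr'.ne']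
          simp
        · rw [Set.indicator_of_notMem (by simpa [norm_polE hr'.le] using h)]
          simp
    _ = ∫⁻ θ in Set.Ioo (-Real.pi) Real.pi, ENNReal.ofReal A := by
        congr 1; ext θ
        rw [lintegral_indicator_one measurableSet_Iio, Measure.restrict_apply measurableSet_Iio]
        rw [Set.inter_comm, Set.Ioi_inter_Iio]; simp
    _ ≤ _ := by
        simp only [lintegral_const, MeasurableSet.univ, Measure.restrict_apply, Set.univ_inter, Real.volume_Ioo]
        rw [← ENNReal.ofReal_mul hA]
        apply ENNReal.ofReal_le_ofReal; linarith

theorem fchar_integrable {h : En 2 → ℂ} (hh : Integrable h) (x : En 2) :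
    Integrable (fun v => Real.fourierChar (inner ℝ v x) • h v) := by
  have := (VectorFourier.fourierIntegral_convergent_iff (μ := volume) (f := h) (L := innerₗ (En 2))
    Real.continuous_fourierChar (by exact continuous_inner) (-x)).2 hh
  refine this.congr ?_
  filter_upwards with v
  simp

theorem sobolev_half {f : En 2 → ℂ} (hf : Continuous f) (hfi : Integrable f)
    (hg1 : Integrable (𝓕 f)) (hg2 : MemLp (𝓕 f) 2) (K : ℝ) (hK : 0 < K)
    (h : ∫⁻ x, ENNReal.ofReal ‖x‖ * ‖𝓕 f x‖ₑ ^ 2 ≤ ENNReal.ofReal K) :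
    ∫⁻ x, ‖f x‖ₑ ^ 4 ≤ ENNReal.ofReal (32 * Real.pi * K ^ 2) := by
  have hpi := Real.pi_pos
  set g := 𝓕 f with hg
  have hgc : Continuous g := 
    VectorFourier.fourierIntegral_continuous Real.continuous_fourierChar
      (by exact continuous_inner) hfi
  let A : ℝ → ℝ := fun l => l ^ 2 / (8 * Real.pi * K)
  let S : ℝ → Set (En 2) := fun l => {x | A l ≤ ‖x‖}
  have hS : ∀ l, MeasurableSet (S l) := fun l => measurableSet_le measurable_const measurable_norm
  let high : ℝ → En 2 → ℂ := fun l => 𝓕⁻ ((S l).indicator g)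
  let low : ℝ → En 2 → ℂ := fun l => 𝓕⁻ ((S l)ᶜ.indicator g)
  have hinv : ∀ l x, f x = low l x + high l x := by
    intro l x
    have e0 : 𝓕⁻ g x = f x := hfi.fourierInv_fourier_eq hg1 hf.continuousAt
    rw [← e0]
    have : g = (S l)ᶜ.indicator g + (S l).indicator g := (Set.indicator_compl_add_self (S l) g).symm
    simp only [low, high, Real.fourierInv_eq]
    rw [← integral_add]
    · congr 1; ext v
      rw [← smul_add]
      congr 1
      exact congrFun this v
    · exact fchar_integrable (hg1.indicator (hS l).compl) x
    · exact fchar_integrable (hg1.indicator (hS l)) x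
  have hlow : ∀ l, 0 < l → ∀ x, ‖low l x‖ ≤ l / 2 := by
    intro l hl x
    have e1 : ‖low l x‖ ≤ ∫ v, ‖(S l)ᶜ.indicator g v‖ := by
      simp only [low, Real.fourierInv_eq]
      refine (norm_integral_le_integral_norm _).trans (le_of_eq ?_)
      congr 1; ext v; simp
    refine e1.trans ?_
    rw [integral_norm_eq_lintegral_enorm (hg1.indicator (hS l).compl).aestronglyMeasurable]
    apply ENNReal.toReal_le_of_le_ofReal (by positivity)
    have hε : 0 < l / (2 * K) := by positivity
    calc _ ≤ ∫⁻ v, (ENNReal.ofReal (l / (4 * K)) * (ENNReal.ofReal ‖v‖ * ‖g v‖ₑ ^ 2)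
          + ENNReal.ofReal (K / l) * Set.indicator {x : En 2 | ‖x‖ < A l} (fun x => ENNReal.ofReal (‖x‖⁻¹)) v) := by
          have h0 : ∀ᵐ v : En 2, v ≠ 0 := by
            simp [ae_iff, measure_singleton]
          apply lintegral_mono_ae
          filter_upwards [h0] with v hv
          have hvn : 0 < ‖v‖ := norm_pos_iff.2 hv
          by_cases hm : ‖v‖ < A l
          · rw [Set.indicator_of_mem (by simpa [S] using hm), Set.indicator_of_mem (by simpa using hm)]
            rw [← ofReal_norm, ← ENNReal.ofReal_pow (norm_nonneg _), ← ENNReal.ofReal_mul (by positivity),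
              ← ENNReal.ofReal_mul (by positivity), ← ENNReal.ofReal_mul (by positivity), ← ENNReal.ofReal_add (by positivity) (by positivity)]
            apply ENNReal.ofReal_le_ofReal
            have : l / (4 * K) * (‖v‖ * ‖g v‖ ^ 2) + K / l * ‖v‖⁻¹ - ‖g v‖
              = (l * ‖v‖ * ‖g v‖ - 2 * K) ^ 2 / (4 * K * l * ‖v‖) := by
              field_simp; ring
            have h2 : 0 ≤ (l * ‖v‖ * ‖g v‖ - 2 * K) ^ 2 / (4 * K * l * ‖v‖) := by positivity
            linarith
          · rw [Set.indicator_of_notMem (by simpa [S] using hm)]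
            simp
      _ ≤ ENNReal.ofReal (l / (4 * K)) * ENNReal.ofReal K + ENNReal.ofReal (K / l) * ENNReal.ofReal (2 * Real.pi * A l) := by
          rw [lintegral_add_left (by fun_prop), lintegral_const_mul _ (by fun_prop), lintegral_const_mul' _ _ (by simp)]
          gcongr
          exact lint_inv_norm _ (by positivity)
      _ = _ := by
          rw [← ENNReal.ofReal_mul (by positivity), ← ENNReal.ofReal_mul (by positivity), ← ENNReal.ofReal_add (by positivity) (by positivity)]
          congr 1
          simp only [A]
          field_simp; ring
  have hhigh : ∀ l, ∫⁻ x, ‖high l x‖ₑ ^ 2 = ∫⁻ x, ‖(S l).indicator g x‖ₑ ^ 2 := by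
    intro l
    rw [← plancherel_L1L2 (hg1.indicator (hS l)) (hg2.indicator (hS l))]
    simp only [high, Real.fourierInv_eq_fourier_neg]
    exact lintegral_neg_eq_self (fun x => ‖𝓕 ((S l).indicator g) x‖ₑ ^ 2)
  have hmeas : Measurable (fun q : En 2 × ℝ => high q.2 q.1) := by
    simp only [high, Real.fourierInv_eq]
    have hsm : StronglyMeasurable (fun z : (En 2 × ℝ) × En 2 => Real.fourierChar (inner ℝ z.2 z.1.1) • (S z.1.2).indicator g z.2) := by
      apply StronglyMeasurable.smul
      · apply Continuous.stronglyMeasurable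
        exact continuous_induced_dom.comp (Real.continuous_fourierChar.comp (by fun_prop : Continuous (fun z : (En 2 × ℝ) × En 2 => inner ℝ z.2 z.1.1)))
      · have : (fun z : (En 2 × ℝ) × En 2 => (S z.1.2).indicator g z.2) =
            Set.indicator {z : (En 2 × ℝ) × En 2 | A z.1.2 ≤ ‖z.2‖} (fun z => g z.2) := by
          ext z; simp [Set.indicator, S]
        rw [this]
        apply StronglyMeasurable.indicator
        · exact (hgc.comp continuous_snd).stronglyMeasurable
        · apply measurableSet_le <;> fun_prop
    exact hsm.integral_prod_right'.measurable
  have hpt : ∀ x, ‖f x‖ₑ ^ 4 ≤ 8 * ∫⁻ l in Set.Ioi 0, ENNReal.ofReal l * ‖high l x‖ₑ ^ 2 := by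
    intro x
    calc ‖f x‖ₑ ^ 4 = 8 * ∫⁻ l in Set.Ioc 0 ‖f x‖, ENNReal.ofReal l * ENNReal.ofReal (‖f x‖ / 2) ^ 2 := by
          rw [lintegral_mul_const _ (by fun_prop), lint_Ioc_id _ (norm_nonneg _), ← ofReal_norm]
          rw [← ENNReal.ofReal_pow (by positivity), ← ENNReal.ofReal_pow (by positivity), ← ENNReal.ofReal_mul (by positivity)]
          rw [show (8 : ℝ≥0∞) = ENNReal.ofReal 8 by simp, ← ENNReal.ofReal_mul (by positivity)]
          congr 1; ring
      _ ≤ 8 * ∫⁻ l in Set.Ioc 0 ‖f x‖, ENNReal.ofReal l * ‖high l x‖ₑ ^ 2 := by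
          gcongr 8 * ?_
          apply setLIntegral_mono' measurableSet_Ioc
          intro l hl
          gcongr
          rw [← ofReal_norm]
          apply ENNReal.ofReal_le_ofReal
          have := hlow l hl.1 x
          have h2 := norm_add_le (low l x) (high l x)
          rw [← hinv] at h2
          linarith [hl.2]
      _ ≤ _ := by
          gcongr 8 * ?_
          exact lintegral_mono_set Set.Ioc_subset_Ioi_self
  calc _ ≤ ∫⁻ x, 8 * ∫⁻ l in Set.Ioi 0, ENNReal.ofReal l * ‖high l x‖ₑ ^ 2 := lintegral_mono hpt
    _ = 8 * ∫⁻ l in Set.Ioi 0, ∫⁻ x, ENNReal.ofReal l * ‖high l x‖ₑ ^ 2 := by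
        rw [lintegral_const_mul' _ _ (by simp), lintegral_lintegral_swap]
        apply Measurable.aemeasurable
        exact (by fun_prop : Measurable (fun q : En 2 × ℝ => ENNReal.ofReal q.2)).mul (hmeas.enorm.pow_const 2)
    _ = 8 * ∫⁻ l in Set.Ioi 0, ∫⁻ x, ENNReal.ofReal l * ‖(S l).indicator g x‖ₑ ^ 2 := by
        congr 2; ext l
        rw [lintegral_const_mul' _ _ (by simp), hhigh, lintegral_const_mul' _ _ (by simp)]
    _ = 8 * ∫⁻ x, ∫⁻ l in Set.Ioi 0, ENNReal.ofReal l * ‖(S l).indicator g x‖ₑ ^ 2 := by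
        rw [lintegral_lintegral_swap]
        apply Measurable.aemeasurable
        have : (fun z : ℝ × En 2 => (S z.1).indicator g z.2) =
            Set.indicator {z : ℝ × En 2 | A z.1 ≤ ‖z.2‖} (fun z => g z.2) := by
          ext z; simp [Set.indicator, S]
        refine Measurable.mul (f := fun z : ℝ × En 2 => ENNReal.ofReal z.1) (g := fun z : ℝ × En 2 => ‖(S z.1).indicator g z.2‖ₑ ^ 2) (by fun_prop) ?_
        apply Measurable.pow_const
        apply Measurable.enorm
        change Measurable (fun z : ℝ × En 2 => (S z.1).indicator g z.2)
        rw [this]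
        apply Measurable.indicator
        · exact (hgc.comp continuous_snd).measurable
        · apply measurableSet_le <;> fun_prop
    _ ≤ 8 * ∫⁻ x, ENNReal.ofReal (4 * Real.pi * K) * (ENNReal.ofReal ‖x‖ * ‖g x‖ₑ ^ 2) := by
        gcongr 8 * ?_
        apply lintegral_mono; intro x
        calc _ ≤ ∫⁻ l in Set.Ioi 0, (Set.Iic (Real.sqrt (8 * Real.pi * K * ‖x‖))).indicator (fun l => ENNReal.ofReal l * ‖g x‖ₑ ^ 2) l := by
              apply setLIntegral_mono' measurableSet_Ioi
              intro l hl
              by_cases hm : A l ≤ ‖x‖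
              · rw [Set.indicator_of_mem (by simpa [S] using hm), Set.indicator_of_mem]
                apply Real.le_sqrt_of_sq_le
                simp only [A] at hm
                rw [div_le_iff₀ (by positivity)] at hm
                linarith
              · rw [Set.indicator_of_notMem (by simpa [S] using hm)]; simp
          _ = ∫⁻ l in Set.Ioc 0 (Real.sqrt (8 * Real.pi * K * ‖x‖)), ENNReal.ofReal l * ‖g x‖ₑ ^ 2 := by
              rw [lintegral_indicator measurableSet_Iic, Measure.restrict_restrict measurableSet_Iic, Set.inter_comm, Set.Ioi_inter_Iic]
          _ ≤ ENNReal.ofReal (4 * Real.pi * K) * (ENNReal.ofReal ‖x‖ * ‖g x‖ₑ ^ 2) := by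
              rw [lintegral_mul_const _ (by fun_prop), lint_Ioc_id _ (Real.sqrt_nonneg _), Real.sq_sqrt (by positivity), ← mul_assoc, ← ENNReal.ofReal_mul (by positivity)]
              apply le_of_eq; congr 2; ring
    _ ≤ 8 * (ENNReal.ofReal (4 * Real.pi * K) * ENNReal.ofReal K) := by
        rw [lintegral_const_mul' _ _ (by simp)]; gcongr
    _ = _ := by
        rw [show (8 : ℝ≥0∞) = ENNReal.ofReal 8 by simp, ← ENNReal.ofReal_mul (by positivity), ← ENNReal.ofReal_mul (by positivity)]
        congr 1; ring


theorem hasDerivAt_param {X : Type*} [MeasurableSpace X] {μ : Measure X} {φ φ' : ℝ → X → ℝ} {w : X → ℝ}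
    (hw : Integrable w μ) (hm : ∀ t, AEStronglyMeasurable (φ t) μ)
    (hm' : ∀ t, AEStronglyMeasurable (φ' t) μ)
    (hb : ∀ T : ℝ, ∃ C, ∀ t, |t| ≤ T → ∀ x, |φ t x| ≤ C * w x)
    (hb' : ∀ T : ℝ, ∃ C, ∀ t, |t| ≤ T → ∀ x, |φ' t x| ≤ C * w x)
    (hd : ∀ t x, HasDerivAt (fun t => φ t x) (φ' t x) t) (t : ℝ) :
    HasDerivAt (fun t => ∫ x, φ t x ∂μ) (∫ x, φ' t x ∂μ) t := by
  obtain ⟨C, hC⟩ := hb (|t| + 1)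
  obtain ⟨C', hC'⟩ := hb' (|t| + 1)
  refine (hasDerivAt_integral_of_dominated_loc_of_deriv_le (F := φ) (F' := φ')
    (bound := fun x => C' * w x) (Metric.ball_mem_nhds t one_pos) ?_ ?_ (hm' t) ?_ (hw.const_mul _) ?_).2
  · exact Filter.Eventually.of_forall hm
  · refine (hw.const_mul C).mono' (hm t) ?_
    filter_upwards with x using hC t (by linarith) x
  · filter_upwards with x s hs
    apply hC' s
    rw [Metric.mem_ball, Real.dist_eq] at hs
    have := abs_sub_abs_le_abs_sub s t
    linarith
  · filter_upwards with x s hs using hd s x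

def wt (s : ℝ) : ℝ := (1 + s ^ 2)⁻¹

theorem wt_pos (s : ℝ) : 0 < wt s := by unfold wt; positivity
theorem wt_le_one (s : ℝ) : wt s ≤ 1 := inv_le_one_of_one_le₀ (by nlinarith [sq_nonneg s])
theorem wt_int : Integrable wt := integrable_inv_one_add_sq
theorem wt_cont : Continuous wt := by
  unfold wt
  exact Continuous.inv₀ (by fun_prop) (fun s => by positivity)

def Dec1 (Φ : ℝ → ℝ → ℝ) : Prop :=
  Continuous (fun q : ℝ × ℝ => Φ q.1 q.2) ∧
    ∀ T : ℝ, ∃ C, ∀ t, |t| ≤ T → ∀ s, |Φ t s| ≤ C * wt s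

theorem Dec1.cont {Φ} (h : Dec1 Φ) (t : ℝ) : Continuous (Φ t) :=
  h.1.comp (Continuous.prodMk_right t)

theorem Dec1.integrable {Φ} (h : Dec1 Φ) (t : ℝ) : Integrable (Φ t) := by
  obtain ⟨C, hC⟩ := h.2 |t|
  refine (wt_int.const_mul C).mono' (h.cont t).aestronglyMeasurable ?_
  filter_upwards with s using hC t le_rfl s

theorem Dec1.mul {Φ Ψ} (h : Dec1 Φ) (h' : Dec1 Ψ) : Dec1 (fun t s => Φ t s * Ψ t s) := by
  refine ⟨h.1.mul h'.1, fun T => ?_⟩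
  obtain ⟨C, hC⟩ := h.2 T
  obtain ⟨C', hC'⟩ := h'.2 T
  refine ⟨C * C', fun t ht s => ?_⟩
  have a1 := hC t ht s
  have a2 := hC' t ht s
  have p := wt_pos s
  have h0 : 0 ≤ C * wt s := (abs_nonneg _).trans a1
  have h0' : 0 ≤ C' * wt s := (abs_nonneg _).trans a2
  have c0' : 0 ≤ C' := nonneg_of_mul_nonneg_left h0' p
  rw [abs_mul]
  calc _ ≤ (C * wt s) * (C' * wt s) := mul_le_mul a1 a2 (abs_nonneg _) h0
    _ ≤ (C * wt s) * (C' * 1) := by gcongr; exact wt_le_one s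
    _ = _ := by ring

theorem Dec1.const_mul {Φ} (h : Dec1 Φ) (c : ℝ) : Dec1 (fun t s => c * Φ t s) := by
  refine ⟨h.1.const_mul c, fun T => ?_⟩
  obtain ⟨C, hC⟩ := h.2 T
  refine ⟨|c| * C, fun t ht s => ?_⟩
  rw [abs_mul, mul_assoc]
  gcongr
  exact hC t ht s

theorem Dec1.neg {Φ} (h : Dec1 Φ) : Dec1 (fun t s => - Φ t s) := by
  simpa using h.const_mul (-1)

theorem Dec1.add {Φ Ψ} (h : Dec1 Φ) (h' : Dec1 Ψ) : Dec1 (fun t s => Φ t s + Ψ t s) := by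
  refine ⟨h.1.add h'.1, fun T => ?_⟩
  obtain ⟨C, hC⟩ := h.2 T
  obtain ⟨C', hC'⟩ := h'.2 T
  refine ⟨C + C', fun t ht s => ?_⟩
  rw [add_mul]
  exact (abs_add_le _ _).trans (add_le_add (hC t ht s) (hC' t ht s))

theorem Dec1.continuous_integral {Φ} (h : Dec1 Φ) : Continuous (fun t => ∫ s, Φ t s) := by
  rw [continuous_iff_continuousAt]
  intro t
  obtain ⟨C, hC⟩ := h.2 (|t| + 1)
  refine continuousAt_of_dominated (bound := fun s => C * wt s) ?_ ?_ (wt_int.const_mul C) ?_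
  · exact Filter.Eventually.of_forall fun t => (h.cont t).aestronglyMeasurable
  · filter_upwards [Metric.ball_mem_nhds t one_pos] with t' ht'
    filter_upwards with s
    apply hC t' _ s
    rw [Metric.mem_ball, Real.dist_eq] at ht'
    have := abs_sub_abs_le_abs_sub t' t
    linarith
  · filter_upwards with s
    exact (h.1.comp (Continuous.prodMk_left s)).continuousAt

theorem Dec1.tendsto_atBot {Φ} (h : Dec1 Φ) (t : ℝ) : Filter.Tendsto (Φ t) Filter.atBot (nhds 0) := by
  obtain ⟨C, hC⟩ := h.2 |t|
  refine squeeze_zero_norm (a := fun s => C * wt s) (fun s => hC t le_rfl s) ?_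
  rw [show (0:ℝ) = C * 0 by simp]
  apply Filter.Tendsto.const_mul
  unfold wt
  apply Filter.Tendsto.inv_tendsto_atTop
  apply Filter.tendsto_atTop_add_const_left
  have := (Filter.tendsto_pow_atTop (α := ℝ) (n := 2) (by norm_num)).comp Filter.tendsto_neg_atBot_atTop
  refine this.congr fun s => by simp

theorem Dec1.hasDerivAt_integral {Φ Φ'} (h : Dec1 Φ) (h' : Dec1 Φ') {μ : Measure ℝ} (hμ : Integrable wt μ)
    (hd : ∀ t s, HasDerivAt (fun t => Φ t s) (Φ' t s) t) (t : ℝ) :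
    HasDerivAt (fun t => ∫ s, Φ t s ∂μ) (∫ s, Φ' t s ∂μ) t :=
  hasDerivAt_param hμ (fun t => (h.cont t).aestronglyMeasurable) (fun t => (h'.cont t).aestronglyMeasurable)
    h.2 h'.2 hd t

def NN (F : ℝ → ℝ → ℝ) (t s : ℝ) : ℝ := 2 * (∫ s' in Set.Iic s, F t s') - ∫ s', F t s'

theorem morawetz1D {F Fs Fss P Ps Pt S A K : ℝ → ℝ → ℝ}
    (dF : Dec1 F) (dFs : Dec1 Fs) (dFss : Dec1 Fss) (dP : Dec1 P) (dPs : Dec1 Ps) (dPt : Dec1 Pt)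
    (dS : Dec1 S)
    (hFs : ∀ t s, HasDerivAt (fun s => F t s) (Fs t s) s)
    (hFss : ∀ t s, HasDerivAt (fun s => Fs t s) (Fss t s) s)
    (hPs : ∀ t s, HasDerivAt (fun s => P t s) (Ps t s) s)
    (hFt : ∀ t s, HasDerivAt (fun t => F t s) (-2 * Ps t s) t)
    (hPt : ∀ t s, HasDerivAt (fun t => P t s) (Pt t s) t)
    (hSs : ∀ t s, HasDerivAt (fun s => S t s) (- Pt t s) s)
    (hS : ∀ t s, S t s = 2 * A t s - 1 / 2 * Fss t s + K t s)
    (F0 : ∀ t s, 0 ≤ F t s) (K0 : ∀ t s, 0 ≤ K t s) (hP : ∀ t s, P t s ^ 2 ≤ F t s * A t s)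
    (a b : ℝ) (hab : a ≤ b) :
    ∫ t in a..b, ∫ s, Fs t s ^ 2 ≤
      (∫ s, F b s) * (∫ s, |P b s|) + (∫ s, F a s) * (∫ s, |P a s|) := by
  have hN : ∀ t s, |NN F t s| ≤ ∫ s', F t s' := by
    intro t s
    have h1 : 0 ≤ ∫ s' in Set.Iic s, F t s' := integral_nonneg (fun s => F0 t s)
    have h2 : ∫ s' in Set.Iic s, F t s' ≤ ∫ s', F t s' :=
      setIntegral_le_integral (dF.integrable t) (by filter_upwards with s using F0 t s)
    unfold NN
    rw [abs_le]; constructor <;> linarith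
  have hNs : ∀ t s, HasDerivAt (fun s => NN F t s) (2 * F t s) s := by
    intro t s
    unfold NN
    have h1 : ∀ s, ∫ s' in Set.Iic s, F t s' = (∫ s' in Set.Iic 0, F t s') + ∫ s' in (0:ℝ)..s, F t s' := by
      intro s
      have := intervalIntegral.integral_Iic_sub_Iic (a := 0) (b := s) (dF.integrable t).integrableOn (dF.integrable t).integrableOn
      rw [← this]; ring
    have h1' : (fun s => 2 * (∫ s' in Set.Iic s, F t s') - ∫ s', F t s') = fun s =>
        2 * ((∫ s' in Set.Iic 0, F t s') + ∫ s' in (0:ℝ)..s, F t s') - ∫ s', F t s' := by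
      funext s; rw [h1 s]
    rw [h1']
    have h2 : HasDerivAt (fun s => ∫ s' in (0:ℝ)..s, F t s') (F t s) s :=
      intervalIntegral.integral_hasDerivAt_right ((dF.integrable t).intervalIntegrable)
        ((dF.cont t).stronglyMeasurableAtFilter _ _) (dF.cont t).continuousAt
    exact ((h2.const_add _).const_mul 2).sub_const _
  have hNc : ∀ t, Continuous (NN F t) := fun t =>
    continuous_iff_continuousAt.2 fun s => (hNs t s).continuousAt
  have dFt : Dec1 (fun t s => -2 * Ps t s) := dPs.const_mul (-2)
  have hmt : ∀ t, HasDerivAt (fun t => ∫ s, F t s) 0 t := by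
    intro t
    have := dF.hasDerivAt_integral dFt (μ := volume) wt_int hFt t
    rwa [integral_const_mul, integral_eq_zero_of_hasDerivAt_of_integrable (hPs t) (dPs.integrable t) (dP.integrable t), mul_zero] at this
  have hNt : ∀ t s, HasDerivAt (fun t => NN F t s) (-4 * P t s) t := by
    intro t s
    have h1 := dF.hasDerivAt_integral dFt (μ := volume.restrict (Set.Iic s)) wt_int.restrict hFt t
    rw [integral_const_mul, integral_Iic_of_hasDerivAt_of_tendsto' (fun x _ => hPs t x) (dPs.integrable t).integrableOn (dP.tendsto_atBot t)] at h1
    have := (h1.const_mul 2).sub (hmt t)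
    convert! this using 1
    ring
  have hmb : ∀ T : ℝ, ∃ C, 0 ≤ C ∧ ∀ t, |t| ≤ T → ∀ s, |NN F t s| ≤ C := by
    intro T
    obtain ⟨C, hC⟩ := dF.2 T
    refine ⟨|C| * ∫ s, wt s, by have : 0 ≤ ∫ s, wt s := integral_nonneg (fun s => (wt_pos s).le)
                                positivity, fun t ht s => (hN t s).trans ?_⟩
    rw [← integral_const_mul]
    apply integral_mono (dF.integrable t) (wt_int.const_mul _)
    intro s
    have := (le_abs_self _).trans (hC t ht s)
    have h2 : C * wt s ≤ |C| * wt s := by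
      have := wt_pos s
      gcongr; exact le_abs_self C
    exact this.trans h2
  have bdd_mul : ∀ Ψ, Dec1 Ψ → ∀ T : ℝ, ∃ C, ∀ t, |t| ≤ T → ∀ s, |NN F t s * Ψ t s| ≤ C * wt s := by
    intro Ψ h T
    obtain ⟨C, hC0, hC⟩ := hmb T
    obtain ⟨C', hC'⟩ := h.2 T
    refine ⟨C * C', fun t ht s => ?_⟩
    rw [abs_mul, mul_assoc]
    exact mul_le_mul (hC t ht s) (hC' t ht s) (abs_nonneg _) hC0
  have int_mul : ∀ Ψ, Dec1 Ψ → ∀ t, Integrable (fun s => NN F t s * Ψ t s) := by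
    intro Ψ h t
    obtain ⟨C, hC⟩ := bdd_mul Ψ h |t|
    refine (wt_int.const_mul C).mono' ((hNc t).mul (h.cont t)).aestronglyMeasurable ?_
    filter_upwards with s using hC t le_rfl s
  let M : ℝ → ℝ := fun t => ∫ s, NN F t s * P t s
  have hM : ∀ t, HasDerivAt M (∫ s, (-4 * (P t s * P t s) + NN F t s * Pt t s)) t := by
    intro t
    refine hasDerivAt_param (φ := fun t s => NN F t s * P t s) (φ' := fun t s => -4 * (P t s * P t s) + NN F t s * Pt t s) (w := wt) wt_int (fun t => ((hNc t).mul (dP.cont t)).aestronglyMeasurable)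
      (fun t => ?_) (bdd_mul P dP) ?_ ?_ t
    · exact (((dP.cont t).mul (dP.cont t)).const_mul (-4) |>.add ((hNc t).mul (dPt.cont t))).aestronglyMeasurable
    · intro T
      obtain ⟨C, hC⟩ := ((dP.mul dP).const_mul (-4)).2 T
      obtain ⟨C', hC'⟩ := bdd_mul Pt dPt T
      refine ⟨C + C', fun t ht s => ?_⟩
      rw [add_mul]
      exact (abs_add_le _ _).trans (add_le_add (hC t ht s) (hC' t ht s))
    · intro t s
      have := (hNt t s).mul (hPt t s)
      convert! this using 1
      ring
  have hD : ∀ t, ∫ s, Fs t s ^ 2 ≤ ∫ s, (-4 * (P t s * P t s) + NN F t s * Pt t s) := by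
    intro t
    have i1 := ((dP.mul dP).const_mul (-4)).integrable t
    have i2 := int_mul Pt dPt t
    have i3 : Integrable (fun s => 2 * F t s * S t s) := by
      simpa [mul_assoc] using ((dF.mul dS).const_mul 2).integrable t
    have e1 : ∫ s, NN F t s * (- Pt t s) = - ∫ s, 2 * F t s * S t s :=
      integral_mul_deriv_eq_deriv_mul_of_integrable (fun s _ => hNs t s) (fun s _ => hSs t s)
        ((int_mul Pt dPt t).neg.congr (by filter_upwards with s; simp)) i3 (int_mul S dS t)
    have e1' : ∫ s, NN F t s * Pt t s = ∫ s, 2 * F t s * S t s := by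
      simp only [mul_neg, integral_neg] at e1
      linarith
    have e2 : ∫ s, F t s * Fss t s = - ∫ s, Fs t s * Fs t s :=
      integral_mul_deriv_eq_deriv_mul_of_integrable (fun s _ => hFs t s) (fun s _ => hFss t s)
        ((dF.mul dFss).integrable t) ((dFs.mul dFs).integrable t) ((dF.mul dFs).integrable t)
    rw [integral_add i1 i2, e1', ← integral_add i1 i3]
    have e3 : ∫ s, Fs t s ^ 2 = ∫ s, - (F t s * Fss t s) := by
      rw [integral_neg, e2]; simp [pow_two]
    rw [e3]
    apply integral_mono ((dF.mul dFss).integrable t).neg (i1.add i3)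
    intro s
    simp only [Pi.add_apply, Pi.neg_apply]
    rw [hS]
    have := hP t s
    have := mul_nonneg (F0 t s) (K0 t s)
    nlinarith
  have hfin : ∫ t in a..b, ∫ s, Fs t s ^ 2 ≤ M b - M a := by
    have hc : Continuous (fun t => ∫ s, Fs t s ^ 2) := by
      simpa [pow_two] using (dFs.mul dFs).continuous_integral
    apply intervalIntegral.integral_le_sub_of_hasDeriv_right_of_le hab
    · exact fun t _ => (hM t).continuousAt.continuousWithinAt
    · exact fun t _ => (hM t).hasDerivWithinAt
    · exact hc.continuousOn.integrableOn_Icc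
    · exact fun t _ => hD t
  have hMb : ∀ t, |M t| ≤ (∫ s, F t s) * ∫ s, |P t s| := by
    intro t
    rw [← integral_const_mul]
    refine (norm_integral_le_integral_norm (fun s => NN F t s * P t s)).trans ?_
    apply integral_mono (int_mul P dP t).norm ((dP.integrable t).norm.const_mul _)
    intro s
    simp only [Real.norm_eq_abs, abs_mul]
    gcongr
    exact hN t s
  have h1 := (abs_le.1 (hMb a)).1
  have h2 := (abs_le.1 (hMb b)).2
  linarith


def Dec2 (φ : ℝ → ℝ → ℝ → ℝ) : Prop :=
  Continuous (fun q : ℝ × ℝ × ℝ => φ q.1 q.2.1 q.2.2) ∧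
    ∀ T : ℝ, ∃ C, 0 ≤ C ∧ ∀ t, |t| ≤ T → ∀ s r, |φ t s r| ≤ C * (wt s * wt r)

theorem Dec2.congr {φ ψ : ℝ → ℝ → ℝ → ℝ} (h : Dec2 φ) (e : ∀ t s r, ψ t s r = φ t s r) : Dec2 ψ := by
  have : ψ = φ := by funext t s r; exact e t s r
  rwa [this]

/-- multiplication by a locally bounded continuous function -/
theorem Dec2.bdd_mul {φ g : ℝ → ℝ → ℝ → ℝ} (h : Dec2 φ)
    (hg : Continuous (fun q : ℝ × ℝ × ℝ => g q.1 q.2.1 q.2.2))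
    (hb : ∀ T : ℝ, ∃ C, 0 ≤ C ∧ ∀ t, |t| ≤ T → ∀ s r, |g t s r| ≤ C) :
    Dec2 (fun t s r => g t s r * φ t s r) := by
  refine ⟨hg.mul h.1, fun T => ?_⟩
  obtain ⟨C, c0, hC⟩ := hb T
  obtain ⟨C', c0', hC'⟩ := h.2 T
  refine ⟨C * C', by positivity, fun t ht s r => ?_⟩
  rw [abs_mul, mul_assoc]
  exact mul_le_mul (hC t ht s r) (hC' t ht s r) (abs_nonneg _) c0

theorem Dec2.bdd {φ} (h : Dec2 φ) : ∀ T : ℝ, ∃ C, 0 ≤ C ∧ ∀ t, |t| ≤ T → ∀ s r, |φ t s r| ≤ C := by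
  intro T
  obtain ⟨C, c0, hC⟩ := h.2 T
  refine ⟨C, c0, fun t ht s r => (hC t ht s r).trans ?_⟩
  have : wt s * wt r ≤ 1 := mul_le_one₀ (wt_le_one s) (wt_pos r).le (wt_le_one r)
  nlinarith

theorem Dec2.mul {φ ψ} (h : Dec2 φ) (h' : Dec2 ψ) : Dec2 (fun t s r => φ t s r * ψ t s r) :=
  h'.bdd_mul h.1 h.bdd

theorem Dec2.const_mul {φ} (c : ℝ) (h : Dec2 φ) : Dec2 (fun t s r => c * φ t s r) :=
  h.bdd_mul (g := fun _ _ _ => c) continuous_const (fun _ => ⟨|c|, abs_nonneg c, fun _ _ _ _ => le_rfl⟩)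

theorem Dec2.neg {φ} (h : Dec2 φ) : Dec2 (fun t s r => - φ t s r) := by
  simpa using h.const_mul (-1)

theorem Dec2.add {φ ψ} (h : Dec2 φ) (h' : Dec2 ψ) : Dec2 (fun t s r => φ t s r + ψ t s r) := by
  refine ⟨h.1.add h'.1, fun T => ?_⟩
  obtain ⟨C, c0, hC⟩ := h.2 T
  obtain ⟨C', c0', hC'⟩ := h'.2 T
  refine ⟨C + C', by positivity, fun t ht s r => ?_⟩
  rw [add_mul]
  exact (abs_add_le _ _).trans (add_le_add (hC t ht s r) (hC' t ht s r))

theorem Dec2.sub {φ ψ} (h : Dec2 φ) (h' : Dec2 ψ) : Dec2 (fun t s r => φ t s r - ψ t s r) := by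
  simpa [sub_eq_add_neg] using h.add h'.neg

theorem Dec2.sq {φ} (h : Dec2 φ) : Dec2 (fun t s r => φ t s r ^ 2) := by
  simpa [pow_two] using h.mul h

theorem Dec2.cont_r {φ} (h : Dec2 φ) (t s : ℝ) : Continuous (φ t s) :=
  h.1.comp (f := fun r => (t, s, r)) (by fun_prop)

theorem Dec2.cont_sr {φ} (h : Dec2 φ) (t : ℝ) : Continuous (fun q : ℝ × ℝ => φ t q.1 q.2) :=
  h.1.comp (f := fun q : ℝ × ℝ => (t, q.1, q.2)) (by fun_prop)

theorem Dec2.bound_r {φ} (h : Dec2 φ) (T : ℝ) : ∃ C, 0 ≤ C ∧ ∀ t, |t| ≤ T → ∀ s r, |φ t s r| ≤ C * wt r := by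
  obtain ⟨C, c0, hC⟩ := h.2 T
  refine ⟨C, c0, fun t ht s r => (hC t ht s r).trans ?_⟩
  gcongr
  nlinarith [wt_le_one s, wt_pos r]

theorem Dec2.int_r {φ} (h : Dec2 φ) (t s : ℝ) : Integrable (φ t s) := by
  obtain ⟨C, c0, hC⟩ := h.bound_r |t|
  refine (wt_int.const_mul C).mono' (h.cont_r t s).aestronglyMeasurable ?_
  filter_upwards with r using hC t le_rfl s r

theorem Dec2.int_sr {φ} (h : Dec2 φ) (t : ℝ) : Integrable (fun q : ℝ × ℝ => φ t q.1 q.2) := by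
  obtain ⟨C, c0, hC⟩ := h.2 |t|
  refine ((wt_int.mul_prod wt_int).const_mul C).mono' (h.cont_sr t).aestronglyMeasurable ?_
  filter_upwards with r using hC t le_rfl r.1 r.2

def LI (φ : ℝ → ℝ → ℝ → ℝ) (t s : ℝ) : ℝ := ∫ r, φ t s r

theorem Dec2.LI {φ} (h : Dec2 φ) : Dec1 (LI φ) := by
  constructor
  · rw [continuous_iff_continuousAt]
    rintro ⟨t, s⟩
    obtain ⟨C, c0, hC⟩ := h.bound_r (|t| + 1)
    refine continuousAt_of_dominated (bound := fun r => C * wt r) ?_ ?_ (wt_int.const_mul C) ?_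
    · exact Filter.Eventually.of_forall fun q => (h.cont_r q.1 q.2).aestronglyMeasurable
    · filter_upwards [continuous_fst.continuousAt.preimage_mem_nhds (Metric.ball_mem_nhds t one_pos)] with q hq
      filter_upwards with r
      apply hC q.1 _ q.2 r
      rw [Set.mem_preimage, Metric.mem_ball, Real.dist_eq] at hq
      have := abs_sub_abs_le_abs_sub q.1 t
      linarith
    · filter_upwards with r
      exact (h.1.comp (f := fun q : ℝ × ℝ => (q.1, q.2, r)) (by fun_prop)).continuousAt
  · intro T
    obtain ⟨C, c0, hC⟩ := h.2 T
    refine ⟨C * ∫ r, wt r, fun t ht s => ?_⟩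
    refine (norm_integral_le_integral_norm (φ t s)).trans ?_
    calc _ ≤ ∫ r, C * (wt s * wt r) := integral_mono (h.int_r t s).norm ((wt_int.const_mul _).const_mul _) (fun r => hC t ht s r)
      _ = _ := by rw [integral_const_mul, integral_const_mul]; ring

theorem LI_deriv_s {φ φs} (h : Dec2 φ) (h' : Dec2 φs)
    (hd : ∀ t s r, HasDerivAt (fun s => φ t s r) (φs t s r) s) (t s : ℝ) :
    HasDerivAt (fun s => LI φ t s) (LI φs t s) s := by
  obtain ⟨C, c0, hC⟩ := h.bound_r |t|
  obtain ⟨C', c0', hC'⟩ := h'.bound_r |t|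
  exact hasDerivAt_param (φ := fun s r => φ t s r) (φ' := fun s r => φs t s r) wt_int
    (fun s => (h.cont_r t s).aestronglyMeasurable) (fun s => (h'.cont_r t s).aestronglyMeasurable)
    (fun T => ⟨C, fun s _ r => hC t le_rfl s r⟩) (fun T => ⟨C', fun s _ r => hC' t le_rfl s r⟩)
    (fun s r => hd t s r) s

theorem LI_deriv_t {φ φt} (h : Dec2 φ) (h' : Dec2 φt)
    (hd : ∀ t s r, HasDerivAt (fun t => φ t s r) (φt t s r) t) (t s : ℝ) :
    HasDerivAt (fun t => LI φ t s) (LI φt t s) t := by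
  refine hasDerivAt_param (φ := fun t r => φ t s r) (φ' := fun t r => φt t s r) wt_int
    (fun t => (h.cont_r t s).aestronglyMeasurable) (fun t => (h'.cont_r t s).aestronglyMeasurable)
    (fun T => ?_) (fun T => ?_)
    (fun t r => hd t s r) t
  · obtain ⟨C, c0, hC⟩ := h.bound_r T
    exact ⟨C, fun t ht r => hC t ht s r⟩
  · obtain ⟨C, c0, hC⟩ := h'.bound_r T
    exact ⟨C, fun t ht r => hC t ht s r⟩

theorem LI_deriv_r {φ φr} (h : Dec2 φ) (h' : Dec2 φr)
    (hd : ∀ t s r, HasDerivAt (fun r => φ t s r) (φr t s r) r) (t s : ℝ) : LI φr t s = 0 :=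
  integral_eq_zero_of_hasDerivAt_of_integrable (hd t s) (h'.int_r t s) (h.int_r t s)

theorem LI_add {φ ψ} (h : Dec2 φ) (h' : Dec2 ψ) (t s : ℝ) :
    LI (fun t s r => φ t s r + ψ t s r) t s = LI φ t s + LI ψ t s :=
  integral_add (h.int_r t s) (h'.int_r t s)

theorem LI_const_mul {φ} (c : ℝ) (t s : ℝ) :
    LI (fun t s r => c * φ t s r) t s = c * LI φ t s := integral_const_mul _ _

theorem LI_congr {φ ψ} (h : ∀ t s r, φ t s r = ψ t s r) (t s : ℝ) : LI φ t s = LI ψ t s := by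
  unfold LI; simp_rw [h]

theorem conservation {e et X Xs Y Yr} (de : Dec2 e) (det : Dec2 et) (dX : Dec2 X) (dXs : Dec2 Xs)
    (dY : Dec2 Y) (dYr : Dec2 Yr)
    (het : ∀ t s r, HasDerivAt (fun t => e t s r) (et t s r) t)
    (hXs : ∀ t s r, HasDerivAt (fun s => X t s r) (Xs t s r) s)
    (hYr : ∀ t s r, HasDerivAt (fun r => Y t s r) (Yr t s r) r)
    (heq : ∀ t s r, et t s r = Xs t s r + Yr t s r) (t : ℝ) :
    ∫ s, LI e t s = ∫ s, LI e 0 s := by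
  have hd : ∀ t, HasDerivAt (fun t => ∫ s, LI e t s) 0 t := by
    intro t
    have h1 := de.LI.hasDerivAt_integral det.LI wt_int (LI_deriv_t de det het) t
    have h2 : ∀ s, LI et t s = LI Xs t s := by
      intro s
      rw [LI_congr heq, LI_add dXs dYr, LI_deriv_r dY dYr hYr, add_zero]
    simp_rw [h2] at h1
    rwa [integral_eq_zero_of_hasDerivAt_of_integrable (LI_deriv_s dX dXs hXs t) (dXs.LI.integrable t) (dX.LI.integrable t)] at h1
  exact is_const_of_deriv_eq_zero (fun t => (hd t).differentiableAt) (fun t => (hd t).deriv) t 0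

theorem cs_integral {X : Type*} [MeasurableSpace X] {μ : Measure X} {f g k : X → ℝ}
    (hf : Integrable f μ) (hg : Integrable g μ) (hk : Integrable k μ) (hg0 : ∀ x, 0 ≤ g x)
    (hf0 : ∀ x, 0 ≤ f x)
    (h : ∀ x, k x ^ 2 ≤ f x * g x) : (∫ x, k x ∂μ) ^ 2 ≤ (∫ x, f x ∂μ) * ∫ x, g x ∂μ := by
  have h1 : ∀ y : ℝ, 0 ≤ (∫ x, f x ∂μ) * (y * y) + (2 * ∫ x, k x ∂μ) * y + ∫ x, g x ∂μ := by
    intro y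
    have : (∫ x, f x ∂μ) * (y * y) + (2 * ∫ x, k x ∂μ) * y + ∫ x, g x ∂μ
        = ∫ x, ((y * y) * f x + (2 * y) * k x + g x) ∂μ := by
      have i1 : Integrable (fun x => (y*y)*f x + (2*y)*k x) μ := (hf.const_mul _).add (hk.const_mul _)
      rw [integral_add i1 hg, integral_add (hf.const_mul _) (hk.const_mul _), integral_const_mul, integral_const_mul]
      ring
    rw [this]
    apply integral_nonneg
    intro x
    simp only [Pi.zero_apply]
    by_cases h0 : f x = 0
    · have := h x
      rw [h0, zero_mul] at this
      have hk0 : k x = 0 := by nlinarith [sq_nonneg (k x)]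
      rw [h0, hk0]; simpa using hg0 x
    · have hp : 0 < f x := lt_of_le_of_ne (hf0 x) (Ne.symm h0)
      have : 0 ≤ f x * (y * y * f x + 2 * y * k x + g x) := by
        nlinarith [sq_nonneg (f x * y + k x), h x]
      exact nonneg_of_mul_nonneg_right this hp
  have := discrim_le_zero h1
  unfold discrim at this
  nlinarith


def SM (v : ℝ → En 2 → ℂ) : Prop := ContDiff ℝ (⊤ : ℕ∞) (fun q : ℝ × En 2 => v q.1 q.2)
def DecC (v : ℝ → En 2 → ℂ) : Prop := ∀ (k N : ℕ) (T : ℝ), ∃ C : ℝ, ∀ t : ℝ, |t| ≤ T → ∀ x : En 2,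
      ‖x‖ ^ N * ‖iteratedFDeriv ℝ k (v t) x‖ ≤ C
def SD (v : ℝ → En 2 → ℂ) : Prop := SM v ∧ DecC v

def Dx (j : Fin 2) (v : ℝ → En 2 → ℂ) : ℝ → En 2 → ℂ := fun t => pd j (v t)
def Dt (v : ℝ → En 2 → ℂ) : ℝ → En 2 → ℂ := fun t x => deriv (fun τ => v τ x) t
def DD (w : ℝ × En 2) (v : ℝ → En 2 → ℂ) : ℝ → En 2 → ℂ :=
  fun t x => fderiv ℝ (fun q : ℝ × En 2 => v q.1 q.2) (t, x) w

theorem SM.diff {v} (h : SM v) : Differentiable ℝ (fun q : ℝ × En 2 => v q.1 q.2) :=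
  ContDiff.differentiable h (by simp)

theorem SM.slice {v} (h : SM v) (t : ℝ) : ContDiff ℝ (⊤ : ℕ∞) (v t) :=
  ContDiff.comp h (f := fun x : En 2 => (t, x)) (by fun_prop)

theorem SM.DD {v} (h : SM v) (w) : SM (DD w v) := by
  have h1 : ContDiff ℝ (⊤ : ℕ∞) (fderiv ℝ (fun q : ℝ × En 2 => v q.1 q.2)) :=
    ContDiff.fderiv_right h (by simp)
  exact h1.clm_apply contDiff_const

theorem Dx_eq {v} (h : SM v) (j) : Dx j v = DD (0, EuclideanSpace.single j 1) v := by
  funext t x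
  have h1 : HasFDerivAt (fun x : En 2 => (t, x)) (ContinuousLinearMap.inr ℝ ℝ (En 2)) x :=
    hasFDerivAt_prodMk_right t x
  have h2 := (h.diff (t, x)).hasFDerivAt.comp x h1
  unfold Dx pd DD
  have h3 : fderiv ℝ (v t) x = _ := h2.fderiv
  rw [h3]
  simp

theorem Dt_eq {v} (h : SM v) : Dt v = DD (1, 0) v := by
  funext t x
  have h1 : HasFDerivAt (fun t : ℝ => (t, x)) (ContinuousLinearMap.inl ℝ ℝ (En 2)) t :=
    hasFDerivAt_prodMk_left t x
  have h2 := ((h.diff (t, x)).hasFDerivAt.comp t h1).hasDerivAt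
  unfold Dt DD
  have h3 : deriv (fun τ => v τ x) t = _ := h2.deriv
  rw [h3]
  simp

theorem DD_comm {v} (h : SM v) (w w') : DD w (DD w' v) = DD w' (DD w v) := by
  funext t x
  have h1 : ContDiff ℝ (⊤ : ℕ∞) (fderiv ℝ (fun q : ℝ × En 2 => v q.1 q.2)) :=
    ContDiff.fderiv_right h (by simp)
  have h1' := (h1.differentiable (by simp)) (t, x)
  have h2 : IsSymmSndFDerivAt ℝ (fun q : ℝ × En 2 => v q.1 q.2) (t, x) :=
    (ContDiff.contDiffAt h).isSymmSndFDerivAt (by simp; exact WithTop.coe_le_coe.2 (le_top : (2:ℕ∞) ≤ ⊤))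
  have key : ∀ w w', DD w (DD w' v) t x = fderiv ℝ (fderiv ℝ (fun q : ℝ × En 2 => v q.1 q.2)) (t, x) w w' := by
    intro w w'
    unfold DD
    simp only [Prod.mk.eta]
    rw [fderiv_clm_apply h1' (differentiableAt_const _)]
    simp
  rw [key, key]
  exact h2 _ _

theorem SM.Dx {v} (h : SM v) (j) : SM (Dx j v) := by rw [Dx_eq h]; exact h.DD _
theorem SM.Dt {v} (h : SM v) : SM (Dt v) := by rw [Dt_eq h]; exact h.DD _
theorem Dx_comm {v} (h : SM v) (i j) : Dx i (Dx j v) = Dx j (Dx i v) := by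
  rw [Dx_eq (h.Dx j), Dx_eq h, Dx_eq (h.Dx i), Dx_eq h, DD_comm h]
theorem Dt_Dx {v} (h : SM v) (j) : Dt (Dx j v) = Dx j (Dt v) := by
  rw [Dt_eq (h.Dx j), Dx_eq h, Dx_eq h.Dt, Dt_eq h, DD_comm h]

theorem SD.Dx {v} (h : SD v) (j) : SD (Dx j v) := by
  refine ⟨h.1.Dx j, fun k N T => ?_⟩
  obtain ⟨C, hC⟩ := h.2 (k+1) N T
  set L : (En 2 →L[ℝ] ℂ) →L[ℝ] ℂ := ContinuousLinearMap.apply ℝ ℂ (EuclideanSpace.single j (1:ℝ)) with hL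
  refine ⟨‖L‖ * C, fun t ht x => ?_⟩
  have h1 : ContDiff ℝ (⊤ : ℕ∞) (fderiv ℝ (v t)) := ContDiff.fderiv_right (h.1.slice t) (by simp)
  have h2 : _root_.Dx j v t = L ∘ (fderiv ℝ (v t)) := by funext x; simp [hL, _root_.Dx, pd]
  have h3 := L.norm_iteratedFDeriv_comp_left (h1.contDiffAt (x := x)) (n := k) (by exact_mod_cast le_top)
  rw [h2]
  rw [norm_iteratedFDeriv_fderiv] at h3
  have := hC t ht x
  calc _ ≤ ‖x‖^N * (‖L‖ * ‖iteratedFDeriv ℝ (k+1) (v t) x‖) := by gcongr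
    _ = ‖L‖ * (‖x‖^N * ‖iteratedFDeriv ℝ (k+1) (v t) x‖) := by ring
    _ ≤ _ := by gcongr

def Xr (v : ℝ → En 2 → ℂ) (t s r : ℝ) : ℝ := (v t (toE (s, r))).re
def Yi (v : ℝ → En 2 → ℂ) (t s r : ℝ) : ℝ := (v t (toE (s, r))).im

theorem SM.cont {v} (h : SM v) : Continuous (fun q : ℝ × ℝ × ℝ => v q.1 (toE (q.2.1, q.2.2))) :=
  h.diff.continuous.comp (f := fun q : ℝ × ℝ × ℝ => (q.1, toE (q.2.1, q.2.2)))
    (continuous_fst.prodMk (toE_cont.comp continuous_snd))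

theorem SM.contX {v} (h : SM v) : Continuous (fun q : ℝ × ℝ × ℝ => Xr v q.1 q.2.1 q.2.2) :=
  Complex.continuous_re.comp h.cont
theorem SM.contY {v} (h : SM v) : Continuous (fun q : ℝ × ℝ × ℝ => Yi v q.1 q.2.1 q.2.2) :=
  Complex.continuous_im.comp h.cont

theorem DecC.bound {v} (h : DecC v) (T : ℝ) : ∃ C, 0 ≤ C ∧ ∀ t, |t| ≤ T → ∀ s r, ‖v t (toE (s,r))‖ ≤ C * (wt s * wt r) := by
  obtain ⟨C0, h0⟩ := h 0 0 T
  obtain ⟨C2, h2⟩ := h 0 2 T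
  obtain ⟨C4, h4⟩ := h 0 4 T
  refine ⟨|C0| + 2 * |C2| + |C4|, by positivity, fun t ht s r => ?_⟩
  have e0 := (h0 t ht (toE (s,r))).trans (le_abs_self _)
  have e2 := (h2 t ht (toE (s,r))).trans (le_abs_self _)
  have e4 := (h4 t ht (toE (s,r))).trans (le_abs_self _)
  simp only [norm_iteratedFDeriv_zero, pow_zero, one_mul] at e0 e2 e4
  have hn := norm_toE (s,r)
  simp only at hn
  have hn4 : ‖toE (s,r)‖^4 = (s^2+r^2)^2 := by rw [← hn]; ring
  rw [hn] at e2
  rw [hn4] at e4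
  unfold wt
  rw [← mul_inv, ← div_eq_mul_inv, le_div_iff₀ (by positivity)]
  have := norm_nonneg (v t (toE (s,r)))
  have k : (1+s^2)*(1+r^2) ≤ 1 + 2*(s^2+r^2) + (s^2+r^2)^2 := by nlinarith [sq_nonneg s, sq_nonneg r, mul_nonneg (sq_nonneg s) (sq_nonneg r), sq_nonneg (s^2), sq_nonneg (r^2)]
  nlinarith [mul_le_mul_of_nonneg_left k this]

theorem SD.decX {v} (h : SD v) : Dec2 (Xr v) := by
  refine ⟨h.1.contX, fun T => ?_⟩
  obtain ⟨C, c0, hC⟩ := h.2.bound T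
  exact ⟨C, c0, fun t ht s r => (Complex.abs_re_le_norm _).trans (hC t ht s r)⟩
theorem SD.decY {v} (h : SD v) : Dec2 (Yi v) := by
  refine ⟨h.1.contY, fun T => ?_⟩
  obtain ⟨C, c0, hC⟩ := h.2.bound T
  exact ⟨C, c0, fun t ht s r => (Complex.abs_im_le_norm _).trans (hC t ht s r)⟩

theorem toE_line_s (s r : ℝ) : HasDerivAt (fun s => toE (s, r)) (EuclideanSpace.single 0 1) s := by
  have : (fun s => toE (s, r)) = fun s : ℝ => s • (EuclideanSpace.single 0 1 : En 2) + toE (0, r) := by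
    funext s; ext i; fin_cases i <;> simp [toE]
  rw [this]
  simpa using ((hasDerivAt_id s).smul_const (EuclideanSpace.single 0 1 : En 2)).add_const (toE (0,r))
theorem toE_line_r (s r : ℝ) : HasDerivAt (fun r => toE (s, r)) (EuclideanSpace.single 1 1) r := by
  have : (fun r => toE (s, r)) = fun r : ℝ => r • (EuclideanSpace.single 1 1 : En 2) + toE (s, 0) := by
    funext s; ext i; fin_cases i <;> simp [toE]
  rw [this]
  simpa using ((hasDerivAt_id r).smul_const (EuclideanSpace.single 1 1 : En 2)).add_const (toE (s,0))

theorem SM.ds {v} (h : SM v) (t s r) : HasDerivAt (fun s => v t (toE (s,r))) (_root_.Dx 0 v t (toE (s,r))) s :=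
  (((h.slice t).differentiable (by simp)) (toE (s,r))).hasFDerivAt.comp_hasDerivAt s (toE_line_s s r)
theorem SM.dr {v} (h : SM v) (t s r) : HasDerivAt (fun r => v t (toE (s,r))) (_root_.Dx 1 v t (toE (s,r))) r :=
  (((h.slice t).differentiable (by simp)) (toE (s,r))).hasFDerivAt.comp_hasDerivAt r (toE_line_r s r)
theorem SM.dt {v} (h : SM v) (t) (x : En 2) : HasDerivAt (fun t => v t x) (_root_.Dt v t x) t := by
  have : Differentiable ℝ (fun t => v t x) := h.diff.comp (f := fun t : ℝ => (t, x)) (by fun_prop)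
  exact (this t).hasDerivAt

theorem re_der {f : ℝ → ℂ} {f' : ℂ} {s : ℝ} (h : HasDerivAt f f' s) : HasDerivAt (fun s => (f s).re) f'.re s :=
  Complex.reCLM.hasFDerivAt.comp_hasDerivAt s h
theorem im_der {f : ℝ → ℂ} {f' : ℂ} {s : ℝ} (h : HasDerivAt f f' s) : HasDerivAt (fun s => (f s).im) f'.im s :=
  Complex.imCLM.hasFDerivAt.comp_hasDerivAt s h

theorem SM.Xs {v} (h : SM v) (t s r) : HasDerivAt (fun s => Xr v t s r) (Xr (_root_.Dx 0 v) t s r) s := re_der (h.ds t s r)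
theorem SM.Ys {v} (h : SM v) (t s r) : HasDerivAt (fun s => Yi v t s r) (Yi (_root_.Dx 0 v) t s r) s := im_der (h.ds t s r)
theorem SM.Xd {v} (h : SM v) (t s r) : HasDerivAt (fun r => Xr v t s r) (Xr (_root_.Dx 1 v) t s r) r := re_der (h.dr t s r)
theorem SM.Yd {v} (h : SM v) (t s r) : HasDerivAt (fun r => Yi v t s r) (Yi (_root_.Dx 1 v) t s r) r := im_der (h.dr t s r)
theorem SM.Xt {v} (h : SM v) (t s r) : HasDerivAt (fun t => Xr v t s r) (Xr (_root_.Dt v) t s r) t := re_der (h.dt t _)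
theorem SM.Yt {v} (h : SM v) (t s r) : HasDerivAt (fun t => Yi v t s r) (Yi (_root_.Dt v) t s r) t := im_der (h.dt t _)

/-- nonlinearity -/
def HH (p a b : ℝ) : ℝ := (a^2+b^2) ^ ((p-1)/2)

theorem HH_nonneg (p a b : ℝ) : 0 ≤ HH p a b := by unfold HH; positivity
theorem HH_cont {p : ℝ} (hp : 1 < p) : Continuous (fun q : ℝ × ℝ => HH p q.1 q.2) := by
  unfold HH
  exact Continuous.rpow_const (by fun_prop) (fun _ => Or.inr (by linarith))
theorem HH_zero {p : ℝ} (hp : 1 < p) : HH p 0 0 = 0 := by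
  unfold HH; simp; rw [Real.zero_rpow (by linarith)]
theorem HH_div {p : ℝ} (hp : 1 < p) (a b : ℝ) : HH p a b / (a^2+b^2) * (a^2+b^2) = HH p a b := by
  by_cases h : a^2+b^2 = 0
  · have ha : a = 0 := by nlinarith [sq_nonneg a, sq_nonneg b]
    have hb : b = 0 := by nlinarith [sq_nonneg a, sq_nonneg b]
    subst ha hb; rw [HH_zero hp]; simp
  · field_simp
theorem HH_div_nonneg (p a b : ℝ) : 0 ≤ HH p a b / (a^2+b^2) := div_nonneg (HH_nonneg _ _ _) (by positivity)
theorem norm_HH (p : ℝ) (z : ℂ) : ‖z‖ ^ (p-1) = HH p z.re z.im := by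
  unfold HH
  rw [Complex.norm_def, Complex.normSq_apply, Real.sqrt_eq_rpow, ← Real.rpow_mul (by nlinarith [sq_nonneg z.re, sq_nonneg z.im])]
  congr 1 <;> ring

theorem HH_der {p : ℝ} (hp : 1 < p) {a b : ℝ → ℝ} {a' b' s : ℝ} (ha : HasDerivAt a a' s) (hb : HasDerivAt b b' s)
    {g : ℝ → ℝ} {g' : ℝ} (hg : HasDerivAt g g' s) (h0 : a s = 0 → b s = 0 → g s = 0) :
    HasDerivAt (fun s => HH p (a s) (b s) * g s)
      (HH p (a s) (b s) * g' + (p-1) * (HH p (a s) (b s) / (a s^2+b s^2)) * (a s*a'+b s*b') * g s) s := by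
  by_cases h : a s^2+b s^2 = 0
  · have ha0 : a s = 0 := by nlinarith [sq_nonneg (a s), sq_nonneg (b s)]
    have hb0 : b s = 0 := by nlinarith [sq_nonneg (a s), sq_nonneg (b s)]
    have hg0 := h0 ha0 hb0
    rw [h, ha0, hb0, hg0, HH_zero hp]
    simp only [zero_mul, mul_zero, add_zero]
    rw [hasDerivAt_iff_tendsto_slope] at hg ⊢
    have e : slope (fun s => HH p (a s) (b s) * g s) s = fun x => HH p (a x) (b x) * slope g s x := by
      funext x
      simp [slope, hg0]; ring
    rw [e]
    have c : ContinuousAt (fun x => HH p (a x) (b x)) s :=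
      ContinuousAt.comp (f := fun x => (a x, b x)) (HH_cont hp).continuousAt (ha.continuousAt.prodMk hb.continuousAt)
    have c1 : Filter.Tendsto (fun x => HH p (a x) (b x)) (nhdsWithin s {s}ᶜ) (nhds 0) := by
      have := c.tendsto
      simp only [ha0, hb0, HH_zero hp] at this
      exact this.mono_left nhdsWithin_le_nhds
    simpa using c1.mul hg
  · have hρ : HasDerivAt (fun s => a s^2+b s^2) (2*(a s*a'+b s*b')) s := by
      have := (ha.pow 2).add (hb.pow 2)
      refine this.congr_deriv ?_
      simp; ring
    have h1 := (hρ.rpow_const (p := (p-1)/2) (Or.inl h)).mul hg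
    refine h1.congr_deriv ?_
    have hpos : 0 < a s^2+b s^2 := lt_of_le_of_ne (by positivity) (Ne.symm h)
    have : HH p (a s) (b s) / (a s^2+b s^2) = (a s^2+b s^2)^((p-1)/2-1) := by
      unfold HH; rw [Real.rpow_sub_one h]
    rw [this]; unfold HH; ring


theorem NLSSolution.SD {p lam u} (h : NLSSolution 2 p lam u) : SD u := ⟨h.smooth, h.decay⟩

theorem eqC {p lam u} (h : NLSSolution 2 p lam u) (t s r : ℝ) :
    Xr (Dt u) t s r = -(Yi (Dx 0 (Dx 0 u)) t s r + Yi (Dx 1 (Dx 1 u)) t s r)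
      + lam * (HH p (Xr u t s r) (Yi u t s r) * Yi u t s r) ∧
    Yi (Dt u) t s r = (Xr (Dx 0 (Dx 0 u)) t s r + Xr (Dx 1 (Dx 1 u)) t s r)
      - lam * (HH p (Xr u t s r) (Yi u t s r) * Xr u t s r) := by
  have e := h.eq t (toE (s,r))
  rw [norm_HH] at e
  have e1 := congrArg Complex.re e
  have e2 := congrArg Complex.im e
  simp [lap, Fin.sum_univ_two] at e1 e2
  unfold Xr Yi Dt Dx
  constructor
  · linarith
  · linarith

theorem eqX {p lam u} (h : NLSSolution 2 p lam u) (t s r : ℝ) :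
    Xr (Dt u) t s r = -(Yi (Dx 0 (Dx 0 u)) t s r + Yi (Dx 1 (Dx 1 u)) t s r)
      + lam * (HH p (Xr u t s r) (Yi u t s r) * Yi u t s r) := (eqC h t s r).1
theorem eqY {p lam u} (h : NLSSolution 2 p lam u) (t s r : ℝ) :
    Yi (Dt u) t s r = (Xr (Dx 0 (Dx 0 u)) t s r + Xr (Dx 1 (Dx 1 u)) t s r)
      - lam * (HH p (Xr u t s r) (Yi u t s r) * Xr u t s r) := (eqC h t s r).2

def QQ (p a b : ℝ) : ℝ := HH p a b / (a^2+b^2)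
theorem QQ_nonneg (p a b) : 0 ≤ QQ p a b := HH_div_nonneg p a b
theorem QQ_mul {p : ℝ} (hp : 1 < p) (a b : ℝ) : QQ p a b * (a^2+b^2) = HH p a b := HH_div hp a b

theorem eqXs {p lam u} (hp : 1 < p) (h : NLSSolution 2 p lam u) (t s r : ℝ) :
    Xr (Dx 0 (Dt u)) t s r = -(Yi (Dx 0 (Dx 0 (Dx 0 u))) t s r + Yi (Dx 0 (Dx 1 (Dx 1 u))) t s r)
      + lam * (HH p (Xr u t s r) (Yi u t s r) * Yi (Dx 0 u) t s r + (p-1) * QQ p (Xr u t s r) (Yi u t s r) *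
        (Xr u t s r * Xr (Dx 0 u) t s r + Yi u t s r * Yi (Dx 0 u) t s r) * Yi u t s r) := by
  have d := h.SD.1
  have h1 := d.Dt.Xs t s r
  have h2 := (((((d.Dx 0).Dx 0).Ys t s r).add (((d.Dx 1).Dx 1).Ys t s r)).neg).add
    ((HH_der hp (d.Xs t s r) (d.Ys t s r) (d.Ys t s r) (fun _ hh => hh)).const_mul lam)
  exact h1.unique (h2.congr_of_eventuallyEq (Filter.Eventually.of_forall fun s => eqX h t s r))

theorem eqXd {p lam u} (hp : 1 < p) (h : NLSSolution 2 p lam u) (t s r : ℝ) :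
    Xr (Dx 1 (Dt u)) t s r = -(Yi (Dx 1 (Dx 0 (Dx 0 u))) t s r + Yi (Dx 1 (Dx 1 (Dx 1 u))) t s r)
      + lam * (HH p (Xr u t s r) (Yi u t s r) * Yi (Dx 1 u) t s r + (p-1) * QQ p (Xr u t s r) (Yi u t s r) *
        (Xr u t s r * Xr (Dx 1 u) t s r + Yi u t s r * Yi (Dx 1 u) t s r) * Yi u t s r) := by
  have d := h.SD.1
  have h1 := d.Dt.Xd t s r
  have h2 := (((((d.Dx 0).Dx 0).Yd t s r).add (((d.Dx 1).Dx 1).Yd t s r)).neg).add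
    ((HH_der hp (d.Xd t s r) (d.Yd t s r) (d.Yd t s r) (fun _ hh => hh)).const_mul lam)
  exact h1.unique (h2.congr_of_eventuallyEq (Filter.Eventually.of_forall fun s => eqX h t _ _))

theorem eqYs {p lam u} (hp : 1 < p) (h : NLSSolution 2 p lam u) (t s r : ℝ) :
    Yi (Dx 0 (Dt u)) t s r = (Xr (Dx 0 (Dx 0 (Dx 0 u))) t s r + Xr (Dx 0 (Dx 1 (Dx 1 u))) t s r)
      - lam * (HH p (Xr u t s r) (Yi u t s r) * Xr (Dx 0 u) t s r + (p-1) * QQ p (Xr u t s r) (Yi u t s r) *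
        (Xr u t s r * Xr (Dx 0 u) t s r + Yi u t s r * Yi (Dx 0 u) t s r) * Xr u t s r) := by
  have d := h.SD.1
  have h1 := d.Dt.Ys t s r
  have h2 := ((((d.Dx 0).Dx 0).Xs t s r).add (((d.Dx 1).Dx 1).Xs t s r)).sub
    ((HH_der hp (d.Xs t s r) (d.Ys t s r) (d.Xs t s r) (fun hh _ => hh)).const_mul lam)
  exact h1.unique (h2.congr_of_eventuallyEq (Filter.Eventually.of_forall fun s => eqY h t s r))

theorem eqYd {p lam u} (hp : 1 < p) (h : NLSSolution 2 p lam u) (t s r : ℝ) :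
    Yi (Dx 1 (Dt u)) t s r = (Xr (Dx 1 (Dx 0 (Dx 0 u))) t s r + Xr (Dx 1 (Dx 1 (Dx 1 u))) t s r)
      - lam * (HH p (Xr u t s r) (Yi u t s r) * Xr (Dx 1 u) t s r + (p-1) * QQ p (Xr u t s r) (Yi u t s r) *
        (Xr u t s r * Xr (Dx 1 u) t s r + Yi u t s r * Yi (Dx 1 u) t s r) * Xr u t s r) := by
  have d := h.SD.1
  have h1 := d.Dt.Yd t s r
  have h2 := ((((d.Dx 0).Dx 0).Xd t s r).add (((d.Dx 1).Dx 1).Xd t s r)).sub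
    ((HH_der hp (d.Xd t s r) (d.Yd t s r) (d.Xd t s r) (fun hh _ => hh)).const_mul lam)
  exact h1.unique (h2.congr_of_eventuallyEq (Filter.Eventually.of_forall fun s => eqY h t _ _))

theorem Dec2.of_le {φ ψ : ℝ → ℝ → ℝ → ℝ} (h : Dec2 ψ) (hc : Continuous (fun q : ℝ × ℝ × ℝ => φ q.1 q.2.1 q.2.2))
    (hb : ∀ t s r, |φ t s r| ≤ ψ t s r) : Dec2 φ := by
  refine ⟨hc, fun T => ?_⟩
  obtain ⟨C, c0, hC⟩ := h.2 T
  exact ⟨C, c0, fun t ht s r => (hb t s r).trans ((le_abs_self _).trans (hC t ht s r))⟩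

theorem Dec2.abs {φ} (h : Dec2 φ) : Dec2 (fun t s r => |φ t s r|) := by
  refine ⟨h.1.abs, fun T => ?_⟩
  obtain ⟨C, c0, hC⟩ := h.2 T
  exact ⟨C, c0, fun t ht s r => by rw [abs_abs]; exact hC t ht s r⟩

theorem Dec2.HH_mul {p : ℝ} (hp : 1 < p) {a b φ} (ha : Dec2 a) (hb : Dec2 b) (h : Dec2 φ) :
    Dec2 (fun t s r => HH p (a t s r) (b t s r) * φ t s r) := by
  refine h.bdd_mul (g := fun t s r => HH p (a t s r) (b t s r)) ?_ ?_
  · exact (HH_cont hp).comp (f := fun q : ℝ × ℝ × ℝ => (a q.1 q.2.1 q.2.2, b q.1 q.2.1 q.2.2)) (ha.1.prodMk hb.1)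
  · intro T
    obtain ⟨C, c0, hC⟩ := ha.bdd T
    obtain ⟨C', c0', hC'⟩ := hb.bdd T
    refine ⟨(C^2+C'^2)^((p-1)/2), by positivity, fun t ht s r => ?_⟩
    rw [abs_of_nonneg (HH_nonneg _ _ _)]
    unfold HH
    apply Real.rpow_le_rpow (by positivity) _ (by linarith)
    have := hC t ht s r
    have := hC' t ht s r
    rw [← sq_abs (a t s r), ← sq_abs (b t s r)]
    gcongr

theorem nl_bound {p : ℝ} (hp : 1 < p) (a b a' b' g g' : ℝ) (hg : |g| ≤ |a| ∨ |g| ≤ |b|) (hg' : |g'| ≤ |a'| + |b'|) :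
    |HH p a b * g' + (p-1) * QQ p a b * (a * a' + b * b') * g| ≤ p * (2 * (HH p a b * (|a'|+|b'|))) := by
  have h1 : |(a*a'+b*b')*g| ≤ 2*((|a'|+|b'|) * (a^2+b^2)) := by
    rw [abs_mul]
    have e1 : |a*a'+b*b'| ≤ |a| * |a'| + |b| * |b'| := by
      refine (abs_add_le _ _).trans ?_
      rw [abs_mul, abs_mul]
    have pa := abs_nonneg a
    have pb := abs_nonneg b
    have pa' := abs_nonneg a'
    have pb' := abs_nonneg b'
    have pg := abs_nonneg g
    have e2 : |g| ≤ |a|+|b| := by rcases hg with h | h <;> linarith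
    have e3 : |a*a'+b*b'| ≤ (|a|+|b|)*(|a'|+|b'|) := by nlinarith [mul_nonneg pa pb', mul_nonneg pb pa']
    rw [← sq_abs a, ← sq_abs b]
    calc _ ≤ ((|a|+|b|)*(|a'|+|b'|)) * (|a|+|b|) := mul_le_mul e3 e2 pg (by positivity)
      _ = (|a'|+|b'|) * (|a|+|b|)^2 := by ring
      _ ≤ (|a'|+|b'|) * (2*(|a|^2+|b|^2)) := by gcongr; nlinarith [sq_nonneg (|a|-|b|)]
      _ = _ := by ring
  have q0 := QQ_nonneg p a b
  have qm := QQ_mul hp a b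
  have h0 := HH_nonneg p a b
  calc _ ≤ |HH p a b * g'| + |(p-1) * QQ p a b * ((a * a' + b * b') * g)| := by
        rw [← mul_assoc]; exact abs_add_le _ _
    _ = HH p a b * |g'| + (p-1) * QQ p a b * |(a * a' + b * b') * g| := by
        rw [abs_mul, abs_mul _ ((a*a'+b*b')*g), abs_of_nonneg h0, abs_of_nonneg (mul_nonneg (by linarith) q0)]
    _ ≤ HH p a b * (|a'|+|b'|) + (p-1) * QQ p a b * (2*((|a'|+|b'|) * (a^2+b^2))) := by
        have : 0 ≤ (p-1) * QQ p a b := mul_nonneg (by linarith) q0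
        gcongr
    _ = HH p a b * (|a'|+|b'|) + (p-1) * (2*(|a'|+|b'|)) * (QQ p a b * (a^2+b^2)) := by ring
    _ ≤ _ := by
      rw [qm]
      have : 0 ≤ HH p a b * (|a'|+|b'|) := by positivity
      nlinarith

theorem dec_nl {p lam : ℝ} (hp : 1 < p) {a b a' b' g g' k1 k2 φ : ℝ → ℝ → ℝ → ℝ}
    (da : Dec2 a) (db : Dec2 b) (da' : Dec2 a') (db' : Dec2 b') (d1 : Dec2 k1) (d2 : Dec2 k2)
    (hg : ∀ t s r, |g t s r| ≤ |a t s r| ∨ |g t s r| ≤ |b t s r|) (hg' : ∀ t s r, |g' t s r| ≤ |a' t s r| + |b' t s r|)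
    (hc : Continuous (fun q : ℝ × ℝ × ℝ => φ q.1 q.2.1 q.2.2))
    (σ : ℝ) (hσ : |σ| = 1)
    (e : ∀ t s r, φ t s r = σ * (k1 t s r + k2 t s r) - σ * (lam * (HH p (a t s r) (b t s r) * g' t s r + (p-1) * QQ p (a t s r) (b t s r) *
      (a t s r * a' t s r + b t s r * b' t s r) * g t s r))) : Dec2 φ := by
  have D : Dec2 (fun t s r => (|k1 t s r| + |k2 t s r|) + |lam| * (p * (2 * (HH p (a t s r) (b t s r) * (|a' t s r| + |b' t s r|))))) :=
    (d1.abs.add d2.abs).add (((Dec2.HH_mul hp da db (da'.abs.add db'.abs)).const_mul 2).const_mul p |>.const_mul |lam|)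
  refine D.of_le hc fun t s r => ?_
  rw [e, ← mul_sub, abs_mul, hσ, one_mul]
  refine (abs_sub _ _).trans (add_le_add (abs_add_le _ _) ?_)
  rw [abs_mul]
  exact mul_le_mul_of_nonneg_left (nl_bound hp _ _ _ _ _ _ (hg t s r) (hg' t s r)) (abs_nonneg _)

theorem decXt {p lam u} (hp : 1 < p) (h : NLSSolution 2 p lam u) : Dec2 (Xr (Dt u)) := by
  have d := h.SD
  exact ((((d.Dx 0).Dx 0).decY.add ((d.Dx 1).Dx 1).decY).neg.add ((Dec2.HH_mul hp d.decX d.decY d.decY).const_mul lam)).congr (eqX h)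
theorem decYt {p lam u} (hp : 1 < p) (h : NLSSolution 2 p lam u) : Dec2 (Yi (Dt u)) := by
  have d := h.SD
  exact ((((d.Dx 0).Dx 0).decX.add ((d.Dx 1).Dx 1).decX).sub ((Dec2.HH_mul hp d.decX d.decY d.decX).const_mul lam)).congr (eqY h)

theorem decXts {p lam u} (hp : 1 < p) (h : NLSSolution 2 p lam u) : Dec2 (Xr (Dx 0 (Dt u))) := by
  have d := h.SD
  refine dec_nl (lam := lam) hp d.decX d.decY (d.Dx 0).decX (d.Dx 0).decY (((d.Dx 0).Dx 0).Dx 0).decY (((d.Dx 1).Dx 1).Dx 0).decY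
    (g := Yi u) (g' := Yi (Dx 0 u)) (fun _ _ _ => Or.inr le_rfl) (fun _ _ _ => by simp) (d.1.Dt.Dx 0).contX (-1) (by simp) ?_
  intro t s r
  rw [eqXs hp h]; ring
theorem decXtd {p lam u} (hp : 1 < p) (h : NLSSolution 2 p lam u) : Dec2 (Xr (Dx 1 (Dt u))) := by
  have d := h.SD
  refine dec_nl (lam := lam) hp d.decX d.decY (d.Dx 1).decX (d.Dx 1).decY (((d.Dx 0).Dx 0).Dx 1).decY (((d.Dx 1).Dx 1).Dx 1).decY
    (g := Yi u) (g' := Yi (Dx 1 u)) (fun _ _ _ => Or.inr le_rfl) (fun _ _ _ => by simp) (d.1.Dt.Dx 1).contX (-1) (by simp) ?_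
  intro t s r
  rw [eqXd hp h]; ring
theorem decYts {p lam u} (hp : 1 < p) (h : NLSSolution 2 p lam u) : Dec2 (Yi (Dx 0 (Dt u))) := by
  have d := h.SD
  refine dec_nl (lam := lam) hp d.decX d.decY (d.Dx 0).decX (d.Dx 0).decY (((d.Dx 0).Dx 0).Dx 0).decX (((d.Dx 1).Dx 1).Dx 0).decX
    (g := Xr u) (g' := Xr (Dx 0 u)) (fun _ _ _ => Or.inl le_rfl) (fun _ _ _ => by simp) (d.1.Dt.Dx 0).contY 1 (by simp) ?_
  intro t s r
  rw [eqYs hp h]; ring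
theorem decYtd {p lam u} (hp : 1 < p) (h : NLSSolution 2 p lam u) : Dec2 (Yi (Dx 1 (Dt u))) := by
  have d := h.SD
  refine dec_nl (lam := lam) hp d.decX d.decY (d.Dx 1).decX (d.Dx 1).decY (((d.Dx 0).Dx 0).Dx 1).decX (((d.Dx 1).Dx 1).Dx 1).decX
    (g := Xr u) (g' := Xr (Dx 1 u)) (fun _ _ _ => Or.inl le_rfl) (fun _ _ _ => by simp) (d.1.Dt.Dx 1).contY 1 (by simp) ?_
  intro t s r
  rw [eqYd hp h]; ring

theorem HHrho_der {p : ℝ} (hp : 1 < p) {a b : ℝ → ℝ} {a' b' s : ℝ} (ha : HasDerivAt a a' s) (hb : HasDerivAt b b' s) :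
    HasDerivAt (fun s => HH p (a s) (b s) * (a s^2+b s^2)) ((p+1) * HH p (a s) (b s) * (a s * a' + b s * b')) s := by
  have hρ : HasDerivAt (fun s => a s^2+b s^2) (2*(a s*a'+b s*b')) s := by
    have := (ha.pow 2).add (hb.pow 2)
    refine this.congr_deriv ?_
    simp; ring
  refine (HH_der hp ha hb hρ (fun h1 h2 => by rw [h1, h2]; simp)).congr_deriv ?_
  have := HH_div hp (a s) (b s)
  linear_combination (p-1)*(a s*a'+b s*b')*this


def rho (u : ℝ → En 2 → ℂ) (t s r : ℝ) : ℝ := Xr u t s r ^ 2 + Yi u t s r ^ 2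
def rhoS (u : ℝ → En 2 → ℂ) (t s r : ℝ) : ℝ :=
  2 * (Xr u t s r * Xr (Dx 0 u) t s r + Yi u t s r * Yi (Dx 0 u) t s r)
def PP (u : ℝ → En 2 → ℂ) (t s r : ℝ) : ℝ := Xr u t s r * Yi (Dx 0 u) t s r - Yi u t s r * Xr (Dx 0 u) t s r
def gr (u : ℝ → En 2 → ℂ) (t s r : ℝ) : ℝ := rho (Dx 0 u) t s r + rho (Dx 1 u) t s r

theorem SD.dec_rho {u} (h : SD u) : Dec2 (rho u) := h.decX.sq.add h.decY.sq
theorem SD.dec_gr {u} (h : SD u) : Dec2 (gr u) := (h.Dx 0).dec_rho.add (h.Dx 1).dec_rho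
theorem SD.dec_rhoS {u} (h : SD u) : Dec2 (rhoS u) :=
  ((h.decX.mul (h.Dx 0).decX).add (h.decY.mul (h.Dx 0).decY)).const_mul 2
theorem SD.dec_PP {u} (h : SD u) : Dec2 (PP u) :=
  (h.decX.mul (h.Dx 0).decY).sub (h.decY.mul (h.Dx 0).decX)

theorem rho_der {a b : ℝ → ℝ} {a' b' s : ℝ} (ha : HasDerivAt a a' s) (hb : HasDerivAt b b' s) :
    HasDerivAt (fun s => a s ^ 2 + b s ^ 2) (2 * (a s * a' + b s * b')) s := by
  refine ((ha.pow 2).add (hb.pow 2)).congr_deriv ?_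
  simp; ring

theorem curl_der {a b c d : ℝ → ℝ} {a' b' c' d' s : ℝ} (ha : HasDerivAt a a' s) (hb : HasDerivAt b b' s)
    (hc : HasDerivAt c c' s) (hd : HasDerivAt d d' s) :
    HasDerivAt (fun s => a s * d s - b s * c s) (a' * d s + a s * d' - (b' * c s + b s * c')) s :=
  (ha.mul hd).sub (hb.mul hc)

theorem mass_cons {p lam u} (hp : 1 < p) (h : NLSSolution 2 p lam u) (t : ℝ) :
    ∫ s, LI (rho u) t s = ∫ s, LI (rho u) 0 s := by
  have d := h.SD
  have m := d.1
  refine conservation (e := rho u)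
    (et := fun t s r => 2 * (Xr u t s r * Xr (Dt u) t s r + Yi u t s r * Yi (Dt u) t s r))
    (X := fun t s r => -2 * (Xr u t s r * Yi (Dx 0 u) t s r - Yi u t s r * Xr (Dx 0 u) t s r))
    (Xs := fun t s r => -2 * (Xr u t s r * Yi (Dx 0 (Dx 0 u)) t s r - Yi u t s r * Xr (Dx 0 (Dx 0 u)) t s r))
    (Y := fun t s r => -2 * (Xr u t s r * Yi (Dx 1 u) t s r - Yi u t s r * Xr (Dx 1 u) t s r))
    (Yr := fun t s r => -2 * (Xr u t s r * Yi (Dx 1 (Dx 1 u)) t s r - Yi u t s r * Xr (Dx 1 (Dx 1 u)) t s r))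
    d.dec_rho (((d.decX.mul (decXt hp h)).add (d.decY.mul (decYt hp h))).const_mul 2)
    (((d.decX.mul (d.Dx 0).decY).sub (d.decY.mul (d.Dx 0).decX)).const_mul (-2))
    (((d.decX.mul ((d.Dx 0).Dx 0).decY).sub (d.decY.mul ((d.Dx 0).Dx 0).decX)).const_mul (-2))
    (((d.decX.mul (d.Dx 1).decY).sub (d.decY.mul (d.Dx 1).decX)).const_mul (-2))
    (((d.decX.mul ((d.Dx 1).Dx 1).decY).sub (d.decY.mul ((d.Dx 1).Dx 1).decX)).const_mul (-2))
    ?_ ?_ ?_ ?_ t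
  · intro t s r; exact rho_der (m.Xt t s r) (m.Yt t s r)
  · intro t s r
    refine ((curl_der (m.Xs t s r) (m.Ys t s r) ((m.Dx 0).Xs t s r) ((m.Dx 0).Ys t s r)).const_mul (-2)).congr_deriv ?_
    ring
  · intro t s r
    refine ((curl_der (m.Xd t s r) (m.Yd t s r) ((m.Dx 1).Xd t s r) ((m.Dx 1).Yd t s r)).const_mul (-2)).congr_deriv ?_
    ring
  · intro t s r
    rw [eqX h, eqY h]; ring

def en (p lam : ℝ) (u : ℝ → En 2 → ℂ) (t s r : ℝ) : ℝ :=
  gr u t s r + 2 * lam / (p+1) * (HH p (Xr u t s r) (Yi u t s r) * rho u t s r)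

theorem dec_en {p lam u} (hp : 1 < p) (d : SD u) : Dec2 (en p lam u) :=
  d.dec_gr.add ((Dec2.HH_mul hp d.decX d.decY d.dec_rho).const_mul (2*lam/(p+1)))

theorem energy_cons {p lam u} (hp : 1 < p) (h : NLSSolution 2 p lam u) (t : ℝ) :
    ∫ s, LI (en p lam u) t s = ∫ s, LI (en p lam u) 0 s := by
  have d := h.SD
  have m := d.1
  have xt := decXt hp h
  have yt := decYt hp h
  have xts := decXts hp h
  have yts := decYts hp h
  have xtd := decXtd hp h
  have ytd := decYtd hp h
  refine conservation (e := en p lam u)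
    (et := fun t s r => 2 * (Xr (Dx 0 u) t s r * Xr (Dx 0 (Dt u)) t s r + Yi (Dx 0 u) t s r * Yi (Dx 0 (Dt u)) t s r)
      + 2 * (Xr (Dx 1 u) t s r * Xr (Dx 1 (Dt u)) t s r + Yi (Dx 1 u) t s r * Yi (Dx 1 (Dt u)) t s r)
      + 2 * lam * (HH p (Xr u t s r) (Yi u t s r) * (Xr u t s r * Xr (Dt u) t s r + Yi u t s r * Yi (Dt u) t s r)))
    (X := fun t s r => 2 * (Xr (Dx 0 u) t s r * Xr (Dt u) t s r + Yi (Dx 0 u) t s r * Yi (Dt u) t s r))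
    (Xs := fun t s r => 2 * ((Xr (Dx 0 (Dx 0 u)) t s r * Xr (Dt u) t s r + Xr (Dx 0 u) t s r * Xr (Dx 0 (Dt u)) t s r)
      + (Yi (Dx 0 (Dx 0 u)) t s r * Yi (Dt u) t s r + Yi (Dx 0 u) t s r * Yi (Dx 0 (Dt u)) t s r)))
    (Y := fun t s r => 2 * (Xr (Dx 1 u) t s r * Xr (Dt u) t s r + Yi (Dx 1 u) t s r * Yi (Dt u) t s r))
    (Yr := fun t s r => 2 * ((Xr (Dx 1 (Dx 1 u)) t s r * Xr (Dt u) t s r + Xr (Dx 1 u) t s r * Xr (Dx 1 (Dt u)) t s r)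
      + (Yi (Dx 1 (Dx 1 u)) t s r * Yi (Dt u) t s r + Yi (Dx 1 u) t s r * Yi (Dx 1 (Dt u)) t s r)))
    (dec_en hp d)
    (((((d.Dx 0).decX.mul xts).add ((d.Dx 0).decY.mul yts)).const_mul 2).add
      ((((d.Dx 1).decX.mul xtd).add ((d.Dx 1).decY.mul ytd)).const_mul 2) |>.add
      ((Dec2.HH_mul hp d.decX d.decY ((d.decX.mul xt).add (d.decY.mul yt))).const_mul (2*lam)))
    ((((d.Dx 0).decX.mul xt).add ((d.Dx 0).decY.mul yt)).const_mul 2)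
    ((((((d.Dx 0).Dx 0).decX.mul xt).add ((d.Dx 0).decX.mul xts)).add
      ((((d.Dx 0).Dx 0).decY.mul yt).add ((d.Dx 0).decY.mul yts))).const_mul 2)
    ((((d.Dx 1).decX.mul xt).add ((d.Dx 1).decY.mul yt)).const_mul 2)
    ((((((d.Dx 1).Dx 1).decX.mul xt).add ((d.Dx 1).decX.mul xtd)).add
      ((((d.Dx 1).Dx 1).decY.mul yt).add ((d.Dx 1).decY.mul ytd))).const_mul 2)
    ?_ ?_ ?_ ?_ t
  · intro t s r
    have e0 := rho_der ((m.Dx 0).Xt t s r) ((m.Dx 0).Yt t s r)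
    have e1 := rho_der ((m.Dx 1).Xt t s r) ((m.Dx 1).Yt t s r)
    rw [Dt_Dx m] at e0 e1
    refine ((e0.add e1).add ((HHrho_der hp (m.Xt t s r) (m.Yt t s r)).const_mul (2*lam/(p+1)))).congr_deriv ?_
    have : p + 1 ≠ 0 := by linarith
    field_simp
  · intro t s r
    exact ((((m.Dx 0).Xs t s r).mul (m.Dt.Xs t s r)).add (((m.Dx 0).Ys t s r).mul (m.Dt.Ys t s r))).const_mul 2
  · intro t s r
    exact ((((m.Dx 1).Xd t s r).mul (m.Dt.Xd t s r)).add (((m.Dx 1).Yd t s r).mul (m.Dt.Yd t s r))).const_mul 2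
  · intro t s r
    linear_combination -2 * Yi (Dt u) t s r * eqX h t s r + 2 * Xr (Dt u) t s r * eqY h t s r

theorem morawetz2 {p lam u} (hp : 1 < p) (hl : 0 < lam) (h : NLSSolution 2 p lam u) (a b : ℝ) (hab : a ≤ b) :
    ∫ t in a..b, ∫ s, LI (rhoS u) t s ^ 2 ≤
      (∫ s, LI (rho u) b s) * (∫ s, |LI (PP u) b s|) + (∫ s, LI (rho u) a s) * (∫ s, |LI (PP u) a s|) := by
  have d := h.SD
  have m := d.1
  have d0 := d.Dx 0
  have d1 := d.Dx 1
  have d00 := d0.Dx 0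
  have d01 := d1.Dx 0
  have d11 := d1.Dx 1
  have d000 := d00.Dx 0
  have d011 := d11.Dx 0
  have xt := decXt hp h
  have yt := decYt hp h
  have xts := decXts hp h
  have yts := decYts hp h
  -- densities
  let A : ℝ → ℝ → ℝ → ℝ := fun t s r => Xr (Dx 0 u) t s r ^ 2 + Yi (Dx 0 u) t s r ^ 2
  let B : ℝ → ℝ → ℝ → ℝ := fun t s r => Xr u t s r * Xr (Dx 0 (Dx 0 u)) t s r + Yi u t s r * Yi (Dx 0 (Dx 0 u)) t s r
  let κ : ℝ := lam * (p-1) / (p+1)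
  let N : ℝ → ℝ → ℝ → ℝ := fun t s r => HH p (Xr u t s r) (Yi u t s r) * rho u t s r
  let fss : ℝ → ℝ → ℝ → ℝ := fun t s r => 2 * (A t s r + B t s r)
  let ps : ℝ → ℝ → ℝ → ℝ := fun t s r => Xr u t s r * Yi (Dx 0 (Dx 0 u)) t s r - Yi u t s r * Xr (Dx 0 (Dx 0 u)) t s r
  let pr : ℝ → ℝ → ℝ → ℝ := fun t s r => Xr u t s r * Yi (Dx 1 (Dx 1 u)) t s r - Yi u t s r * Xr (Dx 1 (Dx 1 u)) t s r
  let pt : ℝ → ℝ → ℝ → ℝ := fun t s r => Xr (Dt u) t s r * Yi (Dx 0 u) t s r + Xr u t s r * Yi (Dx 0 (Dt u)) t s r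
    - (Yi (Dt u) t s r * Xr (Dx 0 u) t s r + Yi u t s r * Xr (Dx 0 (Dt u)) t s r)
  let S : ℝ → ℝ → ℝ → ℝ := fun t s r => A t s r - B t s r + κ * N t s r
  let Ss : ℝ → ℝ → ℝ → ℝ := fun t s r =>
    2 * (Xr (Dx 0 u) t s r * Xr (Dx 0 (Dx 0 u)) t s r + Yi (Dx 0 u) t s r * Yi (Dx 0 (Dx 0 u)) t s r)
    - ((Xr (Dx 0 u) t s r * Xr (Dx 0 (Dx 0 u)) t s r + Xr u t s r * Xr (Dx 0 (Dx 0 (Dx 0 u))) t s r)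
      + (Yi (Dx 0 u) t s r * Yi (Dx 0 (Dx 0 u)) t s r + Yi u t s r * Yi (Dx 0 (Dx 0 (Dx 0 u))) t s r))
    + lam * (p-1) * (HH p (Xr u t s r) (Yi u t s r) * (Xr u t s r * Xr (Dx 0 u) t s r + Yi u t s r * Yi (Dx 0 u) t s r))
  let R : ℝ → ℝ → ℝ → ℝ := fun t s r =>
    (Xr u t s r * Xr (Dx 0 (Dx 1 u)) t s r + Yi u t s r * Yi (Dx 0 (Dx 1 u)) t s r)
    - (Xr (Dx 0 u) t s r * Xr (Dx 1 u) t s r + Yi (Dx 0 u) t s r * Yi (Dx 1 u) t s r)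
  let Rr : ℝ → ℝ → ℝ → ℝ := fun t s r =>
    (Xr u t s r * Xr (Dx 0 (Dx 1 (Dx 1 u))) t s r + Yi u t s r * Yi (Dx 0 (Dx 1 (Dx 1 u))) t s r)
    - (Xr (Dx 0 u) t s r * Xr (Dx 1 (Dx 1 u)) t s r + Yi (Dx 0 u) t s r * Yi (Dx 1 (Dx 1 u)) t s r)
  have dA : Dec2 A := d0.decX.sq.add d0.decY.sq
  have dB : Dec2 B := (d.decX.mul d00.decX).add (d.decY.mul d00.decY)
  have dN : Dec2 N := Dec2.HH_mul hp d.decX d.decY d.dec_rho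
  have dfss : Dec2 fss := (dA.add dB).const_mul 2
  have dps : Dec2 ps := (d.decX.mul d00.decY).sub (d.decY.mul d00.decX)
  have dpr : Dec2 pr := (d.decX.mul d11.decY).sub (d.decY.mul d11.decX)
  have dpr1 : Dec2 (fun t s r => Xr u t s r * Yi (Dx 1 u) t s r - Yi u t s r * Xr (Dx 1 u) t s r) :=
    (d.decX.mul d1.decY).sub (d.decY.mul d1.decX)
  have dpt : Dec2 pt := ((xt.mul d0.decY).add (d.decX.mul yts)).sub ((yt.mul d0.decX).add (d.decY.mul xts))
  have dS : Dec2 S := (dA.sub dB).add (dN.const_mul κ)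
  have dSs : Dec2 Ss := ((((d0.decX.mul d00.decX).add (d0.decY.mul d00.decY)).const_mul 2).sub
    (((d0.decX.mul d00.decX).add (d.decX.mul d000.decX)).add ((d0.decY.mul d00.decY).add (d.decY.mul d000.decY)))).add
    ((Dec2.HH_mul hp d.decX d.decY ((d.decX.mul d0.decX).add (d.decY.mul d0.decY))).const_mul (lam*(p-1)))
  have dR : Dec2 R := ((d.decX.mul d01.decX).add (d.decY.mul d01.decY)).sub ((d0.decX.mul d1.decX).add (d0.decY.mul d1.decY))
  have dRr : Dec2 Rr := ((d.decX.mul d011.decX).add (d.decY.mul d011.decY)).sub ((d0.decX.mul d11.decX).add (d0.decY.mul d11.decY))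
  have ptid : ∀ t s r, Ss t s r = -1 * pt t s r + Rr t s r := by
    intro t s r
    simp only [Ss, pt, Rr]
    rw [eqX h, eqY h, eqXs hp h, eqYs hp h]
    linear_combination (-lam * (p-1) * (Xr u t s r * Xr (Dx 0 u) t s r + Yi u t s r * Yi (Dx 0 u) t s r)) * QQ_mul hp (Xr u t s r) (Yi u t s r)
  refine morawetz1D (F := LI (rho u)) (Fs := LI (rhoS u)) (Fss := LI fss) (P := LI (PP u)) (Ps := LI ps) (Pt := LI pt)
    (S := LI S) (A := LI A) (K := LI (fun t s r => κ * N t s r))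
    d.dec_rho.LI d.dec_rhoS.LI dfss.LI d.dec_PP.LI dps.LI dpt.LI dS.LI ?_ ?_ ?_ ?_ ?_ ?_ ?_ ?_ ?_ ?_ a b hab
  · exact LI_deriv_s d.dec_rho d.dec_rhoS fun t s r => rho_der (m.Xs t s r) (m.Ys t s r)
  · refine LI_deriv_s d.dec_rhoS dfss fun t s r => ?_
    refine ((((m.Xs t s r).mul (d0.1.Xs t s r)).add ((m.Ys t s r).mul (d0.1.Ys t s r))).const_mul 2).congr_deriv ?_
    simp only [fss, A, B]; ring
  · refine LI_deriv_s d.dec_PP dps fun t s r => ?_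
    refine (curl_der (m.Xs t s r) (m.Ys t s r) (d0.1.Xs t s r) (d0.1.Ys t s r)).congr_deriv ?_
    simp only [ps]; ring
  · intro t s
    have dd : Dec2 (fun t s r => 2 * (Xr u t s r * Xr (Dt u) t s r + Yi u t s r * Yi (Dt u) t s r)) :=
      ((d.decX.mul xt).add (d.decY.mul yt)).const_mul 2
    refine (LI_deriv_t d.dec_rho dd (fun t s r => rho_der (m.Xt t s r) (m.Yt t s r)) t s).congr_deriv ?_
    have e : ∀ t s r, 2 * (Xr u t s r * Xr (Dt u) t s r + Yi u t s r * Yi (Dt u) t s r) = -2 * ps t s r + -2 * pr t s r := by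
      intro t s r
      simp only [ps, pr]
      rw [eqX h, eqY h]; ring
    rw [LI_congr e, LI_add (dps.const_mul _) (dpr.const_mul _), LI_const_mul, LI_const_mul,
      LI_deriv_r dpr1 dpr ?_]
    · ring
    · intro t s r
      refine (curl_der (m.Xd t s r) (m.Yd t s r) (d1.1.Xd t s r) (d1.1.Yd t s r)).congr_deriv ?_
      simp only [pr]; ring
  · refine LI_deriv_t d.dec_PP dpt fun t s r => ?_
    have e1 := d0.1.Xt t s r
    have e2 := d0.1.Yt t s r
    rw [Dt_Dx m] at e1 e2
    exact curl_der (m.Xt t s r) (m.Yt t s r) e1 e2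
  · intro t s
    refine (LI_deriv_s dS dSs (fun t s r => ?_) t s).congr_deriv ?_
    · refine (((rho_der (d0.1.Xs t s r) (d0.1.Ys t s r)).sub
        (((m.Xs t s r).mul (d00.1.Xs t s r)).add ((m.Ys t s r).mul (d00.1.Ys t s r)))).add
        ((HHrho_der hp (m.Xs t s r) (m.Ys t s r)).const_mul κ)).congr_deriv ?_
      simp only [Ss, κ]
      have : p + 1 ≠ 0 := by linarith
      field_simp
    · rw [LI_congr ptid, LI_add (dpt.const_mul _) dRr, LI_const_mul, LI_deriv_r dR dRr ?_]
      · ring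
      · intro t s r
        have e1 := d01.1.Xd t s r
        have e2 := d01.1.Yd t s r
        have e3 := d0.1.Xd t s r
        have e4 := d0.1.Yd t s r
        rw [Dx_comm d1.1 1 0] at e1 e2
        rw [Dx_comm m 1 0] at e3 e4
        refine ((((m.Xd t s r).mul e1).add ((m.Yd t s r).mul e2)).sub
          ((e3.mul (d1.1.Xd t s r)).add (e4.mul (d1.1.Yd t s r)))).congr_deriv ?_
        simp only [Rr]; ring
  · intro t s
    have e : ∀ t s r, S t s r = (2 * A t s r + (-(1/2)) * fss t s r) + κ * N t s r := by
      intro t s r; simp only [S, fss]; ring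
    rw [LI_congr e, LI_add ((dA.const_mul _).add (dfss.const_mul _)) (dN.const_mul _), LI_add (dA.const_mul _) (dfss.const_mul _),
      LI_const_mul, LI_const_mul]
    ring
  · intro t s
    exact integral_nonneg fun r => by simp only [rho, Pi.zero_apply]; positivity
  · intro t s
    refine integral_nonneg fun r => ?_
    have : 0 ≤ κ := by simp only [κ]; exact div_nonneg (mul_nonneg hl.le (by linarith)) (by linarith)
    exact mul_nonneg this (mul_nonneg (HH_nonneg _ _ _) (by simp only [rho]; positivity))
  · intro t s
    refine cs_integral (d.dec_rho.int_r t s) (dA.int_r t s) (d.dec_PP.int_r t s) ?_ ?_ ?_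
    · intro r; simp only [A]; positivity
    · intro r; simp only [rho]; positivity
    · intro r
      simp only [rho, A, PP]
      nlinarith [sq_nonneg (Xr u t s r * Xr (Dx 0 u) t s r + Yi u t s r * Yi (Dx 0 u) t s r)]


theorem Dec2.int_E {φ} (h : Dec2 φ) (t : ℝ) (f : En 2 → ℝ) (e : ∀ s r, φ t s r = f (toE (s,r))) :
    Integrable f ∧ ∫ s, _root_.LI φ t s = ∫ x, f x := by
  have h1 := h.int_sr t
  have e1 : (fun q : ℝ × ℝ => φ t q.1 q.2) = f ∘ toE := by funext q; exact e q.1 q.2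
  rw [e1] at h1
  refine ⟨(toE_mp.integrable_comp_emb toE_emb).1 h1, ?_⟩
  rw [← toE_mp.integral_comp toE_emb]
  have h2 := integral_prod _ h1
  unfold _root_.LI
  simp_rw [e]
  exact h2.symm

theorem rho_eq (u : ℝ → En 2 → ℂ) (t s r : ℝ) : rho u t s r = ‖u t (toE (s,r))‖^2 := by
  rw [← Complex.normSq_eq_norm_sq, Complex.normSq_apply]; unfold rho Xr Yi; ring

theorem mass_int {u} (h : SD u) (t : ℝ) : Integrable (fun x => ‖u t x‖^2) ∧ ∫ s, LI (rho u) t s = ∫ x, ‖u t x‖^2 :=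
  h.dec_rho.int_E t (fun x => ‖u t x‖^2) (fun s r => rho_eq u t s r)

theorem grad_int {u} (h : SD u) (t : ℝ) :
    Integrable (fun x => ∑ j, ‖pd j (u t) x‖^2) ∧ ∫ s, LI (gr u) t s = ∫ x, ∑ j, ‖pd j (u t) x‖^2 :=
  h.dec_gr.int_E t (fun x => ∑ j, ‖pd j (u t) x‖^2) (fun s r => by simp only [gr, rho_eq, Fin.sum_univ_two]; rfl)

theorem mass_const {p lam u} (hp : 1 < p) (h : NLSSolution 2 p lam u) (t : ℝ) :
    ∫ x, ‖u t x‖^2 = ∫ x, ‖u 0 x‖^2 := by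
  rw [← (mass_int h.SD t).2, ← (mass_int h.SD 0).2, mass_cons hp h]

theorem grad_bdd {p lam u} (hp : 1 < p) (hl : 0 < lam) (h : NLSSolution 2 p lam u) :
    BddAbove (Set.range fun t => Real.sqrt (∫ x : En 2, ∑ j, ‖pd j (u t) x‖ ^ 2)) := by
  refine ⟨Real.sqrt (∫ s, LI (en p lam u) 0 s), ?_⟩
  rintro _ ⟨t, rfl⟩
  apply Real.sqrt_le_sqrt
  rw [← energy_cons hp h t, ← (grad_int h.SD t).2]
  refine integral_mono (h.SD.dec_gr.LI.integrable t) ((dec_en hp h.SD).LI.integrable t) fun s => ?_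
  refine integral_mono (h.SD.dec_gr.int_r t s) ((dec_en hp h.SD).int_r t s) fun r => ?_
  unfold en
  have : 0 ≤ 2 * lam / (p+1) * (HH p (Xr u t s r) (Yi u t s r) * rho u t s r) :=
    mul_nonneg (div_nonneg (by linarith) (by linarith)) (mul_nonneg (HH_nonneg _ _ _) (by unfold rho; positivity))
  linarith

theorem PP_bound {u} (h : SD u) (t : ℝ) :
    ∫ s, |LI (PP u) t s| ≤ Real.sqrt (∫ x, ‖u t x‖^2) * Real.sqrt (∫ x : En 2, ∑ j, ‖pd j (u t) x‖ ^ 2) := by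
  rw [← (mass_int h t).2, ← (grad_int h t).2]
  have n1 : ∀ s, 0 ≤ LI (rho u) t s := fun s => integral_nonneg fun r => by simp only [rho, Pi.zero_apply]; positivity
  have n2 : ∀ s, 0 ≤ LI (gr u) t s := fun s => integral_nonneg fun r => by simp only [gr, rho, Pi.zero_apply]; positivity
  have k := cs_integral (h.dec_rho.LI.integrable t) (h.dec_gr.LI.integrable t) (h.dec_PP.LI.integrable t).abs n2 n1 ?_
  · rw [← Real.sqrt_mul (integral_nonneg n1)]
    exact Real.le_sqrt_of_sq_le k
  · intro s
    rw [sq_abs]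
    refine cs_integral (h.dec_rho.int_r t s) (h.dec_gr.int_r t s) (h.dec_PP.int_r t s) ?_ ?_ ?_
    · intro r; simp only [gr, rho]; positivity
    · intro r; simp only [rho]; positivity
    · intro r
      simp only [rho, gr, PP]
      have p1 : 0 ≤ (Xr u t s r ^ 2 + Yi u t s r ^ 2) * (Xr (Dx 1 u) t s r ^ 2 + Yi (Dx 1 u) t s r ^ 2) := by positivity
      nlinarith [sq_nonneg (Xr u t s r * Xr (Dx 0 u) t s r + Yi u t s r * Yi (Dx 0 u) t s r)]

theorem morawetz3 {p lam u} (hp : 1 < p) (hl : 0 < lam) (h : NLSSolution 2 p lam u) {G : ℝ}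
    (hG : ∀ t, Real.sqrt (∫ x : En 2, ∑ j, ‖pd j (u t) x‖ ^ 2) ≤ G) (T : ℝ) (hT : 0 ≤ T) :
    ∫ t in (-T)..T, ∫ s, LI (rhoS u) t s ^ 2 ≤ 2 * (∫ x, ‖u 0 x‖^2) * Real.sqrt (∫ x, ‖u 0 x‖^2) * G := by
  refine (morawetz2 hp hl h (-T) T (by linarith)).trans ?_
  rw [mass_cons hp h, mass_cons hp h (-T), (mass_int h.SD 0).2]
  have b : ∀ t, ∫ s, |LI (PP u) t s| ≤ Real.sqrt (∫ x, ‖u 0 x‖^2) * G := by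
    intro t
    refine (PP_bound h.SD t).trans ?_
    rw [mass_const hp h]
    exact mul_le_mul_of_nonneg_left (hG t) (Real.sqrt_nonneg _)
  have m0 : 0 ≤ ∫ x, ‖u 0 x‖^2 := integral_nonneg fun x => by positivity
  have b1 := mul_le_mul_of_nonneg_left (b T) m0
  have b2 := mul_le_mul_of_nonneg_left (b (-T)) m0
  linarith

/-! rotation -/
def rotL (θ : ℝ) : En 2 →ₗ[ℝ] En 2 where
  toFun x := toE (Real.cos θ * x 0 - Real.sin θ * x 1, Real.sin θ * x 0 + Real.cos θ * x 1)
  map_add' x y := by ext i; fin_cases i <;> simp [toE] <;> ring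
  map_smul' c x := by ext i; fin_cases i <;> simp [toE] <;> ring

def rotI (θ : ℝ) : En 2 →ₗᵢ[ℝ] En 2 where
  toLinearMap := rotL θ
  norm_map' x := by
    have h : ‖rotL θ x‖^2 = ‖x‖^2 := by
      have e : rotL θ x = toE (Real.cos θ * x 0 - Real.sin θ * x 1, Real.sin θ * x 0 + Real.cos θ * x 1) := rfl
      rw [e, norm_toE, EuclideanSpace.norm_sq_eq]
      simp only [Fin.sum_univ_two, Real.norm_eq_abs, sq_abs]
      linear_combination (x 0 ^2 + x 1^2) * Real.sin_sq_add_cos_sq θ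
    exact (sq_eq_sq₀ (norm_nonneg _) (norm_nonneg _)).1 h

def rot (θ : ℝ) : En 2 ≃ₗᵢ[ℝ] En 2 := (rotI θ).toLinearIsometryEquiv rfl

theorem rot_apply (θ : ℝ) (x : En 2) :
    rot θ x = toE (Real.cos θ * x 0 - Real.sin θ * x 1, Real.sin θ * x 0 + Real.cos θ * x 1) := rfl

theorem rot_pol (θ τ : ℝ) : rot θ (toE (τ, 0)) = polE τ θ := by
  rw [rot_apply]; unfold polE; congr 1; simp [toE]; constructor <;> ring

theorem rot_e0 (θ : ℝ) : rot θ (EuclideanSpace.single 0 1) = Real.cos θ • EuclideanSpace.single 0 1 + Real.sin θ • EuclideanSpace.single 1 1 := by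
  rw [rot_apply]; ext i; fin_cases i <;> simp [toE]
theorem rot_e1 (θ : ℝ) : rot θ (EuclideanSpace.single 1 1) = (-Real.sin θ) • EuclideanSpace.single 0 1 + Real.cos θ • EuclideanSpace.single 1 1 := by
  rw [rot_apply]; ext i; fin_cases i <;> simp [toE]

theorem pd_rot {f : En 2 → ℂ} (hf : Differentiable ℝ f) (θ : ℝ) (x : En 2) :
    pd 0 (fun x => f (rot θ x)) x = Real.cos θ * pd 0 f (rot θ x) + Real.sin θ * pd 1 f (rot θ x) ∧
    pd 1 (fun x => f (rot θ x)) x = -Real.sin θ * pd 0 f (rot θ x) + Real.cos θ * pd 1 f (rot θ x) := by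
  have h1 : HasFDerivAt (fun x => f (rot θ x)) _ x :=
    (hf (rot θ x)).hasFDerivAt.comp x (rot θ).toContinuousLinearEquiv.hasFDerivAt
  unfold pd
  rw [h1.fderiv]
  constructor
  · simp [rot_e0]
  · simp [rot_e1]

theorem pd_lin {f g : En 2 → ℂ} (hf : Differentiable ℝ f) (hg : Differentiable ℝ g) (c d : ℂ) (j : Fin 2) (x : En 2) :
    pd j (fun x => c * f x + d * g x) x = c * pd j f x + d * pd j g x := by
  unfold pd
  have h1 : HasFDerivAt (fun x => c * f x + d * g x) _ x := ((hf x).hasFDerivAt.const_mul c).add ((hg x).hasFDerivAt.const_mul d)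
  rw [h1.fderiv]
  simp

theorem pd_smooth {f : En 2 → ℂ} (hf : ContDiff ℝ (⊤ : ℕ∞) f) (j : Fin 2) : ContDiff ℝ (⊤ : ℕ∞) (pd j f) := by
  have h1 : ContDiff ℝ (⊤ : ℕ∞) (fderiv ℝ f) := ContDiff.fderiv_right hf (by simp)
  exact h1.clm_apply contDiff_const

theorem lap_rot {f : En 2 → ℂ} (hf : ContDiff ℝ (⊤ : ℕ∞) f) (θ : ℝ) (x : En 2) :
    lap (fun x => f (rot θ x)) x = lap f (rot θ x) := by
  have d := hf.differentiable (by simp)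
  have d0 := (pd_smooth hf 0).differentiable (by simp)
  have d1 := (pd_smooth hf 1).differentiable (by simp)
  have e0 : pd 0 (fun x => f (rot θ x)) = fun x => (fun y => (Real.cos θ : ℂ) * pd 0 f y + (Real.sin θ : ℂ) * pd 1 f y) (rot θ x) := by
    funext x; exact (pd_rot d θ x).1
  have e1 : pd 1 (fun x => f (rot θ x)) = fun x => (fun y => (-Real.sin θ : ℂ) * pd 0 f y + (Real.cos θ : ℂ) * pd 1 f y) (rot θ x) := by
    funext x; exact (pd_rot d θ x).2
  have D0 : Differentiable ℝ (fun y => (Real.cos θ : ℂ) * pd 0 f y + (Real.sin θ : ℂ) * pd 1 f y) :=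
    (d0.const_mul _).add (d1.const_mul _)
  have D1 : Differentiable ℝ (fun y => (-Real.sin θ : ℂ) * pd 0 f y + (Real.cos θ : ℂ) * pd 1 f y) :=
    (d0.const_mul _).add (d1.const_mul _)
  unfold lap
  rw [Fin.sum_univ_two, Fin.sum_univ_two, e0, e1, (pd_rot D0 θ x).1, (pd_rot D1 θ x).2, pd_lin d0 d1, pd_lin d0 d1, pd_lin d0 d1, pd_lin d0 d1]
  have : (Real.sin θ : ℂ)^2 + (Real.cos θ : ℂ)^2 = 1 := by exact_mod_cast congrArg (fun x : ℝ => (x : ℂ)) (Real.sin_sq_add_cos_sq θ)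
  linear_combination (pd 0 (pd 0 f) (rot θ x) + pd 1 (pd 1 f) (rot θ x)) * this

theorem NLS_rot {p lam u} (h : NLSSolution 2 p lam u) (θ : ℝ) : NLSSolution 2 p lam (fun t x => u t (rot θ x)) where
  smooth := h.smooth.comp (f := fun q : ℝ × En 2 => (q.1, rot θ q.2))
    (contDiff_fst.prodMk ((rot θ).contDiff.comp contDiff_snd))
  decay k N T := by
    obtain ⟨C, hC⟩ := h.decay k N T
    refine ⟨C, fun t ht x => ?_⟩
    have := (rot θ).norm_iteratedFDeriv_comp_right (𝕜 := ℝ) (u t) x k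
    have e : (fun x => u t (rot θ x)) = u t ∘ rot θ := rfl
    rw [e, this, ← (rot θ).norm_map x]
    exact hC t ht _
  eq t x := by
    rw [lap_rot (h.SD.1.slice t)]
    exact h.eq t (rot θ x)

theorem mass_rot (u : ℝ → En 2 → ℂ) (θ t : ℝ) : ∫ x, ‖u t (rot θ x)‖^2 = ∫ x, ‖u t x‖^2 :=
  (rot θ).measurePreserving.integral_comp (rot θ).toHomeomorph.measurableEmbedding (fun x => ‖u t x‖^2)

theorem grad_rot {u} (h : SM u) (θ t : ℝ) :
    ∫ x : En 2, ∑ j, ‖pd j (fun x => u t (rot θ x)) x‖^2 = ∫ x : En 2, ∑ j, ‖pd j (u t) x‖^2 := by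
  rw [← (rot θ).measurePreserving.integral_comp (rot θ).toHomeomorph.measurableEmbedding (fun x => ∑ j, ‖pd j (u t) x‖^2)]
  congr 1
  funext x
  have d := (h.slice t).differentiable (by simp)
  rw [Fin.sum_univ_two, Fin.sum_univ_two, (pd_rot d θ x).1, (pd_rot d θ x).2]
  simp only [← Complex.normSq_eq_norm_sq, Complex.normSq_apply]
  have k := Real.sin_sq_add_cos_sq θ
  simp only [Complex.add_re, Complex.add_im, Complex.mul_re, Complex.mul_im, Complex.neg_re, Complex.neg_im, Complex.ofReal_re, Complex.ofReal_im]
  linear_combination ((pd 0 (u t) (rot θ x)).re^2 + (pd 0 (u t) (rot θ x)).im^2 + (pd 1 (u t) (rot θ x)).re^2 + (pd 1 (u t) (rot θ x)).im^2) * k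


def rc (u : ℝ → En 2 → ℂ) (t : ℝ) (x : En 2) : ℂ := ((‖u t x‖ ^ 2 : ℝ) : ℂ)

theorem rc_schwartz {u} (h : SD u) (t : ℝ) : ∃ f : SchwartzMap (En 2) ℂ, ⇑f = rc u t := by
  let U : SchwartzMap (En 2) ℂ := ⟨u t, h.1.slice t, fun k n => by
    obtain ⟨C, hC⟩ := h.2 n k |t|
    exact ⟨C, fun x => hC t le_rfl x⟩⟩
  let V : SchwartzMap (En 2) ℂ := U.postcompCLM (𝕜 := ℝ) (Complex.conjCLE : ℂ →L[ℝ] ℂ)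
  refine ⟨SchwartzMap.bilinLeftCLM (ContinuousLinearMap.mul ℝ ℂ) V.hasTemperateGrowth U, ?_⟩
  funext x
  have e1 : V x = starRingEnd ℂ (u t x) := rfl
  have e2 : U x = u t x := rfl
  rw [SchwartzMap.bilinLeftCLM_apply]
  simp only [ContinuousLinearMap.mul_apply', e1, e2]
  rw [Complex.mul_conj]
  unfold rc
  rw [Complex.normSq_eq_norm_sq]

theorem inner_toE (q : ℝ × ℝ) (τ : ℝ) : inner ℝ (toE q) (toE (τ, 0)) = q.1 * τ := by
  rw [PiLp.inner_apply]
  simp [toE, mul_comm]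

theorem fourier_slice {u} (h : SD u) (t τ : ℝ) :
    𝓕 (fun s => (LI (rho u) t s : ℂ)) τ = 𝓕 (rc u t) (toE (τ, 0)) := by
  obtain ⟨f, hf⟩ := rc_schwartz h t
  rw [Real.fourier_real_eq, Real.fourier_eq, ← toE_mp.integral_comp toE_emb]
  have i1 : Integrable (fun x => (Real.fourierChar (-(inner ℝ x (toE (τ,0))))) • rc u t x) := by
    rw [← hf]
    exact (Real.fourierIntegral_convergent_iff (toE (τ,0))).2 f.integrable
  have i2 := (toE_mp.integrable_comp_emb toE_emb).2 i1
  have i3 := integral_prod _ i2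
  refine Eq.trans ?_ i3.symm
  congr 1
  funext s
  simp only [Function.comp, inner_toE]
  simp only [Circle.smul_def, smul_eq_mul]
  rw [integral_const_mul]
  congr 1
  unfold LI
  simp only [rho_eq]
  exact integral_ofReal.symm

theorem plancherel_slice {u} (h : SD u) (t : ℝ) :
    ENNReal.ofReal (∫ s, LI (rhoS u) t s ^ 2) =
      ∫⁻ τ : ℝ, ENNReal.ofReal ((2 * Real.pi * τ)^2) * ‖𝓕 (rc u t) (toE (τ, 0))‖ₑ ^ 2 := by
  have m := h.1
  have hd : ∀ s, HasDerivAt (fun s => (LI (rho u) t s : ℂ)) (LI (rhoS u) t s : ℂ) s := fun s =>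
    (LI_deriv_s h.dec_rho h.dec_rhoS (fun t s r => rho_der (m.Xs t s r) (m.Ys t s r)) t s).ofReal_comp
  have e : deriv (fun s => (LI (rho u) t s : ℂ)) = fun s => (LI (rhoS u) t s : ℂ) := by
    funext s; exact (hd s).deriv
  have i1 : Integrable (fun s => (LI (rho u) t s : ℂ)) := (h.dec_rho.LI.integrable t).ofReal
  have i2 : Integrable (fun s => (LI (rhoS u) t s : ℂ)) := (h.dec_rhoS.LI.integrable t).ofReal
  have d := h.dec_rhoS.LI
  have isq : Integrable (fun s => LI (rhoS u) t s ^ 2) := by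
    simpa [pow_two] using (d.mul d).integrable t
  have i3 : MemLp (fun s => (LI (rhoS u) t s : ℂ)) 2 := by
    have : MemLp (fun s => LI (rhoS u) t s) 2 := (memLp_two_iff_integrable_sq (d.cont t).aestronglyMeasurable).2 isq
    exact this.ofReal
  have F := Real.fourier_deriv i1 (fun s => (hd s).differentiableAt) (by rw [e]; exact i2)
  rw [e] at F
  have P := plancherel_L1L2 i2 i3
  rw [ofReal_integral_eq_lintegral_ofReal isq (by filter_upwards with s using sq_nonneg _)]
  have e1 : ∀ s, ENNReal.ofReal (LI (rhoS u) t s ^ 2) = ‖(LI (rhoS u) t s : ℂ)‖ₑ^2 := by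
    intro s
    rw [← ofReal_norm, Complex.norm_real, ← ENNReal.ofReal_pow (norm_nonneg _), Real.norm_eq_abs, sq_abs]
  simp_rw [e1]
  rw [← P, F]
  congr 1
  funext τ
  simp only []
  rw [fourier_slice h, enorm_smul, mul_pow]
  congr 1
  rw [← ofReal_norm, ← ENNReal.ofReal_pow (norm_nonneg _)]
  congr 1
  simp [abs_of_pos Real.pi_pos, mul_pow]

theorem slice_rot {p lam u} (h : NLSSolution 2 p lam u) (t θ : ℝ) :
    ENNReal.ofReal (∫ s, LI (rhoS (fun t x => u t (rot θ x))) t s ^ 2) =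
      ∫⁻ τ : ℝ, ENNReal.ofReal ((2 * Real.pi * τ)^2) * ‖𝓕 (rc u t) (polE τ θ)‖ₑ ^ 2 := by
  rw [plancherel_slice (NLS_rot h θ).SD]
  congr 1
  funext τ
  have e : rc (fun t x => u t (rot θ x)) t = rc u t ∘ rot θ := rfl
  rw [e, Real.fourier_comp_linearIsometry, rot_pol]

theorem meas_G {u} (h : SM u) : Measurable (fun q : ℝ × En 2 => 𝓕 (rc u q.1) q.2) := by
  have c : Continuous (fun z : (ℝ × En 2) × En 2 => Real.fourierChar (-(inner ℝ z.2 z.1.2)) • rc u z.1.1 z.2) := by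
    have c1 : Continuous (fun z : (ℝ × En 2) × En 2 => rc u z.1.1 z.2) := by
      unfold rc
      have := h.diff.continuous.comp (f := fun z : (ℝ × En 2) × En 2 => (z.1.1, z.2)) (by fun_prop)
      exact Complex.continuous_ofReal.comp (this.norm.pow 2)
    have c2 : Continuous (fun z : (ℝ × En 2) × En 2 => Real.fourierChar (-(inner ℝ z.2 z.1.2))) :=
      Real.continuous_fourierChar.comp (by fun_prop)
    exact c2.smul c1
  have s := c.stronglyMeasurable.integral_prod_right' (ν := (volume : Measure (En 2)))
  have e : (fun q : ℝ × En 2 => 𝓕 (rc u q.1) q.2) = fun q => ∫ x, Real.fourierChar (-(inner ℝ x q.2)) • rc u q.1 x := by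
    funext q; rw [Real.fourier_eq]
  rw [e]
  exact s.measurable

theorem cont_sq {p lam u} (h : NLSSolution 2 p lam u) : Continuous (fun t => ∫ s, LI (rhoS u) t s ^ 2) := by
  have d := h.SD.dec_rhoS.LI
  simpa [pow_two] using (d.mul d).continuous_integral

def KK (u : ℝ → En 2 → ℂ) (t : ℝ) : ℝ≥0∞ := ∫⁻ ξ, ENNReal.ofReal ‖ξ‖ * ‖𝓕 (rc u t) ξ‖ₑ ^ 2

theorem KK_bound {p lam u} (hp : 1 < p) (hl : 0 < lam) (h : NLSSolution 2 p lam u) {G : ℝ}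
    (hG : ∀ t, Real.sqrt (∫ x : En 2, ∑ j, ‖pd j (u t) x‖ ^ 2) ≤ G) (T : ℝ) (hT : 0 ≤ T) :
    ∫⁻ t in Set.Ioc (-T) T, KK u t ≤
      ENNReal.ofReal (2 * Real.pi) * ENNReal.ofReal (2 * (∫ x, ‖u 0 x‖^2) * Real.sqrt (∫ x, ‖u 0 x‖^2) * G) := by
  set B := 2 * (∫ x, ‖u 0 x‖^2) * Real.sqrt (∫ x, ‖u 0 x‖^2) * G with hB
  have mG := meas_G h.SD.1
  have step : ∀ θ : ℝ, ∫⁻ t in Set.Ioc (-T) T, ∫⁻ τ in Set.Ioi 0, ENNReal.ofReal τ * (ENNReal.ofReal ‖polE τ θ‖ * ‖𝓕 (rc u t) (polE τ θ)‖ₑ ^ 2) ≤ ENNReal.ofReal B := by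
    intro θ
    have M := morawetz3 hp hl (NLS_rot h θ) (G := G) (fun t => by rw [grad_rot h.SD.1]; exact hG t) T hT
    rw [mass_rot, ← hB] at M
    refine le_trans ?_ (ENNReal.ofReal_le_ofReal M)
    rw [intervalIntegral.integral_of_le (by linarith)]
    rw [ofReal_integral_eq_lintegral_ofReal]
    · refine lintegral_mono fun t => ?_
      rw [slice_rot h]
      refine le_trans (lintegral_mono_ae ?_) (setLIntegral_le_lintegral (Set.Ioi 0) _)
      filter_upwards [ae_restrict_mem measurableSet_Ioi] with τ hτ
      have hτ' : (0:ℝ) < τ := hτ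
      rw [← mul_assoc, ← ENNReal.ofReal_mul hτ'.le, norm_polE hτ'.le]
      gcongr
      rw [← pow_two]
      gcongr
      nlinarith [Real.pi_gt_three]
    · exact (cont_sq (NLS_rot h θ)).integrableOn_Ioc
    · filter_upwards with t using integral_nonneg fun s => sq_nonneg _
  have mf : Measurable (fun z : (ℝ × ℝ) × ℝ => ENNReal.ofReal z.2 * (ENNReal.ofReal ‖polE z.2 z.1.2‖ * ‖𝓕 (rc u z.1.1) (polE z.2 z.1.2)‖ₑ ^ 2)) := by
    have hpol : Continuous (fun q : ℝ × ℝ => polE q.1 q.2) := polE_cont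
    have c : Measurable (fun z : (ℝ × ℝ) × ℝ => polE z.2 z.1.2) :=
      (hpol.comp (f := fun z : (ℝ × ℝ) × ℝ => (z.2, z.1.2)) (by fun_prop)).measurable
    have c2 : Measurable (fun z : (ℝ × ℝ) × ℝ => 𝓕 (rc u z.1.1) (polE z.2 z.1.2)) :=
      mG.comp (f := fun z : (ℝ × ℝ) × ℝ => (z.1.1, polE z.2 z.1.2)) (by fun_prop)
    exact (ENNReal.measurable_ofReal.comp measurable_snd).mul
      ((ENNReal.measurable_ofReal.comp c.norm).mul (c2.enorm.pow_const 2))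
  calc ∫⁻ t in Set.Ioc (-T) T, KK u t
      = ∫⁻ t in Set.Ioc (-T) T, ∫⁻ θ in Set.Ioo (-Real.pi) Real.pi, ∫⁻ τ in Set.Ioi 0, ENNReal.ofReal τ * (ENNReal.ofReal ‖polE τ θ‖ * ‖𝓕 (rc u t) (polE τ θ)‖ₑ ^ 2) := by
        congr 1
        funext t
        unfold KK
        rw [lint_polar]
        have : Measurable (fun ξ => 𝓕 (rc u t) ξ) := mG.comp (f := fun ξ : En 2 => (t, ξ)) (by fun_prop)
        exact (ENNReal.measurable_ofReal.comp measurable_norm).mul (this.enorm.pow_const 2)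
    _ = ∫⁻ θ in Set.Ioo (-Real.pi) Real.pi, ∫⁻ t in Set.Ioc (-T) T, ∫⁻ τ in Set.Ioi 0, ENNReal.ofReal τ * (ENNReal.ofReal ‖polE τ θ‖ * ‖𝓕 (rc u t) (polE τ θ)‖ₑ ^ 2) := by
        rw [lintegral_lintegral_swap]
        exact (mf.lintegral_prod_right' (ν := volume.restrict (Set.Ioi 0))).aemeasurable
    _ ≤ ∫⁻ θ in Set.Ioo (-Real.pi) Real.pi, ENNReal.ofReal B := lintegral_mono step
    _ = _ := by
        rw [setLIntegral_const, Real.volume_Ioo, mul_comm]; congr 2; ring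

theorem sob_t {p lam u} (h : NLSSolution 2 p lam u) (t : ℝ) :
    ENNReal.ofReal (Real.sqrt (∫ x : En 2, ‖u t x‖^8)) ≤ ENNReal.ofReal (Real.sqrt (32 * Real.pi)) * KK u t := by
  obtain ⟨f, hf⟩ := rc_schwartz h.SD t
  have hF : ⇑(𝓕 f : SchwartzMap (En 2) ℂ) = 𝓕 (rc u t) := by rw [SchwartzMap.fourier_coe, hf]
  have hp := Real.pi_pos
  by_cases hK : KK u t = ⊤
  · rw [hK, ENNReal.mul_top (by simp [ENNReal.ofReal_eq_zero, hp])]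
    exact le_top
  set k := (KK u t).toReal with hk
  have hk0 : 0 ≤ k := ENNReal.toReal_nonneg
  have hkk : KK u t = ENNReal.ofReal k := (ENNReal.ofReal_toReal hK).symm
  rw [hkk, ← ENNReal.ofReal_mul (Real.sqrt_nonneg _)]
  apply ENNReal.ofReal_le_ofReal
  have main : ∀ ε > 0, Real.sqrt (∫ x : En 2, ‖u t x‖^8) ≤ Real.sqrt (32 * Real.pi) * (k + ε) := by
    intro ε hε
    have S := sobolev_half (f := rc u t) (by rw [← hf]; exact f.continuous) (by rw [← hf]; exact f.integrable)
      (by rw [← hF]; exact (𝓕 f : SchwartzMap (En 2) ℂ).integrable) (by rw [← hF]; exact (𝓕 f : SchwartzMap (En 2) ℂ).memLp 2) (k + ε) (by linarith)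
      (by
        have : KK u t ≤ ENNReal.ofReal (k + ε) := by rw [hkk]; exact ENNReal.ofReal_le_ofReal (by linarith)
        exact this)
    have e : ∀ x, ‖rc u t x‖ₑ^4 = ENNReal.ofReal (‖u t x‖^8) := by
      intro x
      unfold rc
      rw [← ofReal_norm, Complex.norm_real, ← ENNReal.ofReal_pow (norm_nonneg _), Real.norm_eq_abs, abs_of_nonneg (by positivity)]
      congr 1; ring
    simp_rw [e] at S
    have I : ∫ x : En 2, ‖u t x‖^8 ≤ 32 * Real.pi * (k+ε)^2 := by
      have c8 : Continuous (fun x => ‖u t x‖^8) := (h.SD.1.slice t).continuous.norm.pow 8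
      rw [integral_eq_lintegral_of_nonneg_ae (f := fun x => ‖u t x‖^8) (Filter.Eventually.of_forall fun x => by simp only [Pi.zero_apply]; positivity)
        c8.aestronglyMeasurable]
      exact ENNReal.toReal_le_of_le_ofReal (by positivity) S
    calc _ ≤ Real.sqrt (32 * Real.pi * (k+ε)^2) := Real.sqrt_le_sqrt I
      _ = _ := by rw [Real.sqrt_mul (by positivity), Real.sqrt_sq (by linarith)]
  refine le_of_forall_pos_le_add fun δ hδ => ?_
  have s0 : 0 < Real.sqrt (32 * Real.pi) := Real.sqrt_pos.2 (by positivity)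
  have := main (δ / Real.sqrt (32 * Real.pi)) (by positivity)
  rw [mul_add, mul_div_cancel₀ _ s0.ne'] at this
  exact this


/-- `L⁴ₜL⁸ₓ` bound in two dimensions. -/
theorem statement_12 :
    ∃ C : ℝ, 0 < C ∧
      ∀ (p lam : ℝ), 1 < p → 0 < lam →
        ∀ u : ℝ → En 2 → ℂ, NLSSolution 2 p lam u →
          Real.sqrt (∫ t : ℝ, Real.sqrt (∫ x : En 2, ‖u t x‖ ^ 8))
            ≤ C * (Real.sqrt (∫ x : En 2, ‖u 0 x‖ ^ 2)) ^ ((3 : ℝ) / 2)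
                * (⨆ t : ℝ, Real.sqrt (∫ x : En 2, ∑ j, ‖pd j (u t) x‖ ^ 2)) ^ ((1 : ℝ) / 2) := by
  have hpi := Real.pi_pos
  set D : ℝ := Real.sqrt (32 * Real.pi) * (2 * Real.pi) * 2 with hD
  have D0 : 0 < D := by positivity
  refine ⟨Real.sqrt D, Real.sqrt_pos.2 D0, ?_⟩
  intro p lam hp hl u h
  set m : ℝ := ∫ x : En 2, ‖u 0 x‖ ^ 2 with hm
  have m0 : 0 ≤ m := integral_nonneg fun x => by positivity
  set G : ℝ := ⨆ t : ℝ, Real.sqrt (∫ x : En 2, ∑ j, ‖pd j (u t) x‖ ^ 2) with hGd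
  have hG : ∀ t, Real.sqrt (∫ x : En 2, ∑ j, ‖pd j (u t) x‖ ^ 2) ≤ G :=
    fun t => le_ciSup (grad_bdd hp hl h) t
  have G0 : 0 ≤ G := (Real.sqrt_nonneg _).trans (hG 0)
  by_cases hi : Integrable (fun t : ℝ => Real.sqrt (∫ x : En 2, ‖u t x‖ ^ 8))
  swap
  · rw [integral_undef hi, Real.sqrt_zero]
    positivity
  set a := Real.sqrt m with ha
  have a0 : 0 ≤ a := Real.sqrt_nonneg _
  have ma : m = a ^ 2 := (Real.sq_sqrt m0).symm
  have B : ∀ T : ℝ, 0 ≤ T → ∫ t in (-T)..T, Real.sqrt (∫ x : En 2, ‖u t x‖ ^ 8) ≤ D * a ^ 3 * G := by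
    intro T hT
    rw [intervalIntegral.integral_of_le (by linarith),
      integral_eq_lintegral_of_nonneg_ae (Filter.Eventually.of_forall fun t => Real.sqrt_nonneg _)
        hi.aestronglyMeasurable.restrict]
    refine ENNReal.toReal_le_of_le_ofReal (by positivity) ?_
    calc _ ≤ ∫⁻ t in Set.Ioc (-T) T, ENNReal.ofReal (Real.sqrt (32 * Real.pi)) * KK u t :=
          lintegral_mono fun t => sob_t h t
      _ = ENNReal.ofReal (Real.sqrt (32 * Real.pi)) * ∫⁻ t in Set.Ioc (-T) T, KK u t :=
          lintegral_const_mul' _ _ ENNReal.ofReal_ne_top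
      _ ≤ ENNReal.ofReal (Real.sqrt (32 * Real.pi)) *
          (ENNReal.ofReal (2*Real.pi) * ENNReal.ofReal (2 * m * a * G)) :=
          mul_le_mul_right (KK_bound hp hl h hG T hT) _
      _ = _ := by
          rw [← ENNReal.ofReal_mul (by positivity), ← ENNReal.ofReal_mul (by positivity)]
          congr 1
          rw [ma, hD]; ring
  have lim := intervalIntegral_tendsto_integral hi Filter.tendsto_neg_atTop_atBot
    (Filter.tendsto_id (α := ℝ) (x := Filter.atTop))
  have fin : ∫ t : ℝ, Real.sqrt (∫ x : En 2, ‖u t x‖ ^ 8) ≤ D * a ^ 3 * G :=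
    le_of_tendsto lim (Filter.eventually_atTop.2 ⟨0, fun T hT => B T hT⟩)
  refine (Real.sqrt_le_sqrt fin).trans (le_of_eq ?_)
  rw [Real.sqrt_mul (by positivity), Real.sqrt_mul D0.le, Real.sqrt_eq_rpow G,
    Real.sqrt_eq_rpow (a ^ 3), ← Real.rpow_natCast a 3, ← Real.rpow_mul a0]
  norm_num
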